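/- arXiv:1511.08416 — 5 statements merged into one kernel-verified Lean document; each statement's English description precedes it below -/
import Mathlib

section
/- For every fixed integer k ≥ 1 there exists a constant N_k such that for every tournament on n players with n ≥ N_k and n a power of two, every player that maximizes the number of directed k-paths originating from it is an SE winner. -/
/-- A tournament relation on `V`: irreflexive, asymmetric, and total. -/
structure IsTournament {V : Type*} (beats : V → V → Prop) : Prop where
  irrefl : ∀ v, ¬ beats v v
  asymm : ∀ u v, beats u v → ¬ beats v u
  total : ∀ u v, u ≠ v → beats u v ∨ beats v u

/-- `SEWinner beats S v` : the player `v` can win a balanced single-elimination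
tournament among the players of `S` under some seeding.  Either `S = {v}`, or `S`
can be partitioned into pairs (via a fixed-point-free involution `f` of `S`) such
that `v` is an SE winner of the set `W` of winners of the pairs. -/
inductive SEWinner {V : Type*} (beats : V → V → Prop) : Finset V → V → Prop
  | single (v : V) : SEWinner beats {v} v
  | round (S W : Finset V) (f : V → V) (v : V)
      (hf : ∀ x ∈ S, f x ∈ S ∧ f x ≠ x ∧ f (f x) = x)
      (hW : ∀ x, x ∈ W ↔ x ∈ S ∧ beats x (f x))
      (hw : SEWinner beats W v) : SEWinner beats S v

/-- A king: every other player is beaten by `v` or by someone `v` beats. -/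
def IsKing {V : Type*} (beats : V → V → Prop) (v : V) : Prop :=
  ∀ u, u ≠ v → beats v u ∨ ∃ w, beats v w ∧ beats w u

/-- A 3-king: every other player is reachable from `v` in at most 3 steps. -/
def IsThreeKing {V : Type*} (beats : V → V → Prop) (v : V) : Prop :=
  ∀ u, u ≠ v → beats v u ∨ (∃ w, beats v w ∧ beats w u) ∨
    ∃ w x, beats v w ∧ beats w x ∧ beats x u

/-- The out-degree of a player. -/
noncomputable def outDeg {V : Type*} [Fintype V] (beats : V → V → Prop) (v : V) : ℕ :=
  {u | beats v u}.ncard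

/-- The number of directed `k`-paths originating at `v`. -/
noncomputable def kPathCount {V : Type*} [Fintype V] (beats : V → V → Prop) (k : ℕ) (v : V) : ℕ :=
  {p : Fin (k + 1) → V | Function.Injective p ∧ p 0 = v ∧
    ∀ i : Fin k, beats (p i.castSucc) (p i.succ)}.ncard

/-- A superking: a king `v` such that every player beating `v` is beaten by at
least `log₂ n` players whom `v` beats. -/
def IsSuperking {V : Type*} [Fintype V] (beats : V → V → Prop) (v : V) : Prop :=
  IsKing beats v ∧ ∀ u, beats u v →
    Real.logb 2 (Fintype.card V) ≤ ({w | beats v w ∧ beats w u}.ncard : ℝ)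


section Rounds
variable {V : Type} {beats : V → V → Prop}

/-- One round of pairings of `S` with set of winners `W`. -/
inductive Rnd [DecidableEq V] (beats : V → V → Prop) : Finset V → Finset V → Prop
  | nil : Rnd beats ∅ ∅
  | cons (a b : V) (S W : Finset V) (ha : a ∉ S) (hb : b ∉ S) (hab : beats a b)
      (h : Rnd beats S W) : Rnd beats (insert a (insert b S)) (insert a W)

variable [DecidableEq V]

theorem Rnd.sub {S W : Finset V} (h : Rnd beats S W) : W ⊆ S := by
  induction h with
  | nil => simp
  | cons a b S W ha hb hab h ih =>
    intro x hx
    simp only [Finset.mem_insert] at hx ⊢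
    rcases hx with h | h
    · exact Or.inl h
    · exact Or.inr (Or.inr (ih h))

theorem Rnd.card (hT : IsTournament beats) {S W : Finset V} (h : Rnd beats S W) :
    S.card = 2 * W.card := by
  induction h with
  | nil => simp
  | cons a b S W ha hb hab h ih =>
    have hne : a ≠ b := by
      rintro rfl; exact hT.irrefl _ hab
    rw [Finset.card_insert_of_notMem (by simp [hne, ha]), Finset.card_insert_of_notMem hb,
      Finset.card_insert_of_notMem (fun h' => ha (h.sub h'))]
    omega

theorem Rnd.union {S W S' W' : Finset V} (h : Rnd beats S W) (h' : Rnd beats S' W')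
    (hd : Disjoint S S') : Rnd beats (S ∪ S') (W ∪ W') := by
  induction h with
  | nil => simpa using h'
  | cons a b S W ha hb hab h ih =>
    simp only [Finset.disjoint_insert_left] at hd
    simp only [Finset.insert_union]
    exact Rnd.cons a b _ _ (by simp [ha, hd.1]) (by simp [hb, hd.2.1]) hab (ih hd.2.2)

theorem Rnd.pair {a b : V} (hab : beats a b) : Rnd beats {a, b} {a} := by
  have := Rnd.cons a b ∅ ∅ (by simp) (by simp) hab Rnd.nil
  simpa using this

theorem Rnd.invol (hT : IsTournament beats) {S W : Finset V} (h : Rnd beats S W) :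
    ∃ f : V → V, (∀ x ∈ S, f x ∈ S ∧ f x ≠ x ∧ f (f x) = x) ∧
      ∀ x, x ∈ W ↔ x ∈ S ∧ beats x (f x) := by
  induction h with
  | nil => exact ⟨id, by simp, by simp⟩
  | cons a b S W ha hb hab h ih =>
    obtain ⟨f, hf, hW⟩ := ih
    have hne : a ≠ b := by
      rintro rfl; exact hT.irrefl _ hab
    have hba := hT.asymm _ _ hab
    have hSa : ∀ x ∈ S, x ≠ a := fun x hx h => ha (h ▸ hx)
    have hSb : ∀ x ∈ S, x ≠ b := fun x hx h => hb (h ▸ hx)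
    refine ⟨fun x => if x = a then b else if x = b then a else f x, ?_, ?_⟩
    · intro x hx
      simp only [Finset.mem_insert] at hx
      rcases hx with rfl | rfl | hx
      · simp [hne.symm]
      · simp [hne, hne.symm]
      · have h1 := hf x hx
        simp [hSa x hx, hSb x hx, hSa _ h1.1, hSb _ h1.1, h1.1, h1.2.1, h1.2.2]
    · intro x
      simp only [Finset.mem_insert]
      by_cases hxa : x = a
      · subst hxa; simp [hab]
      · by_cases hxb : x = b
        · subst hxb
          have : x ∉ W := fun h' => hb (h.sub h')
          simp [hne.symm, this, hba]
        · simp [hxa, hxb, hW]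

theorem Rnd.win (hT : IsTournament beats) {S W : Finset V} (h : Rnd beats S W) {v : V}
    (hw : SEWinner beats W v) : SEWinner beats S v := by
  obtain ⟨f, hf, hW⟩ := h.invol hT
  exact SEWinner.round S W f v hf hW hw

theorem exists_rnd (hT : IsTournament beats) (m : ℕ) : ∀ S : Finset V, S.card = 2 * m →
    ∃ W, Rnd beats S W := by
  induction m with
  | zero =>
    intro S hS
    have : S = ∅ := by simpa using hS
    subst this
    exact ⟨∅, Rnd.nil⟩
  | succ m ih =>
    intro S hS
    obtain ⟨a, ha⟩ : S.Nonempty := by rw [← Finset.card_pos]; omega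
    have h1 := Finset.card_erase_of_mem ha
    obtain ⟨b, hb⟩ : (S.erase a).Nonempty := by rw [← Finset.card_pos]; omega
    have h2 := Finset.card_erase_of_mem hb
    obtain ⟨W, hW⟩ := ih ((S.erase a).erase b) (by omega)
    have hab : a ≠ b := (Finset.ne_of_mem_erase hb).symm
    rcases hT.total a b hab with h | h
    · refine ⟨insert a W, ?_⟩
      have := Rnd.cons a b _ _ (by simp) (by simp) h hW
      rwa [Finset.insert_erase hb, Finset.insert_erase ha] at this
    · refine ⟨insert b W, ?_⟩
      have := Rnd.cons b a _ _ (by simp) (by simp) h hW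
      rwa [Finset.insert_comm, Finset.insert_erase hb, Finset.insert_erase ha] at this

theorem exists_rnd_even (hT : IsTournament beats) (S : Finset V) (h : Even S.card) :
    ∃ W, Rnd beats S W := by
  obtain ⟨m, hm⟩ := h
  exact exists_rnd hT m S (by omega)

/-- pairs coming from an injection -/
theorem rnd_inj (I : Finset V) (g : V → V) (hg : Set.InjOn g I)
    (hb : ∀ u ∈ I, beats (g u) u) (hd : Disjoint I (I.image g)) :
    Rnd beats (I ∪ I.image g) (I.image g) := by
  induction I using Finset.induction_on with
  | empty => simpa using Rnd.nil
  | insert a I ha ih =>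
    have hI := ih (hg.mono (by simp)) (fun u hu => hb u (by simp [hu]))
      (hd.mono (Finset.subset_insert _ _) (Finset.image_subset_image (Finset.subset_insert _ _)))
    have h1 : g a ∉ I ∪ I.image g := by
      intro h
      rcases Finset.mem_union.1 h with h | h
      · exact Finset.disjoint_left.1 hd (Finset.mem_insert_of_mem h)
          (Finset.mem_image_of_mem g (Finset.mem_insert_self a I))
      · obtain ⟨x, hx, hxa⟩ := Finset.mem_image.1 h
        have := hg (by simp [hx]) (by simp) hxa
        exact ha (this ▸ hx)
    have h2 : a ∉ I ∪ I.image g := by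
      intro h
      rcases Finset.mem_union.1 h with h | h
      · exact ha h
      · exact Finset.disjoint_left.1 hd (Finset.mem_insert_self a I)
          (Finset.image_subset_image (Finset.subset_insert _ _) h)
    have := Rnd.cons (g a) a _ _ h1 h2 (hb a (by simp)) hI
    convert this using 1
    · ext x
      simp only [Finset.mem_union, Finset.mem_insert, Finset.image_insert]
      tauto
    · simp

/-- inclusion-maximal matching -/
theorem rnd_matching (n : ℕ) : ∀ X Y : Finset V, X.card = n → Disjoint X Y →
    ∃ X₁ Y₁, X₁ ⊆ X ∧ Y₁ ⊆ Y ∧ X₁.card = Y₁.card ∧ Rnd beats (X₁ ∪ Y₁) X₁ ∧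
      ∀ a ∈ X \ X₁, ∀ b ∈ Y \ Y₁, ¬ beats a b := by
  induction n with
  | zero =>
    intro X Y hX _
    have : X = ∅ := by simpa using hX
    subst this
    exact ⟨∅, ∅, by simp, by simp, rfl, by simpa using Rnd.nil, by simp⟩
  | succ n ih =>
    intro X Y hX hd
    by_cases h : ∃ a ∈ X, ∃ b ∈ Y, beats a b
    · obtain ⟨a, ha, b, hb, hab⟩ := h
      obtain ⟨X₁, Y₁, h1, h2, h3, h4, h5⟩ := ih (X.erase a) (Y.erase b)
        (by rw [Finset.card_erase_of_mem ha]; omega)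
        (hd.mono (Finset.erase_subset _ _) (Finset.erase_subset _ _))
      have haX : a ∉ X₁ := fun h => by simpa using h1 h
      have hbY : b ∉ Y₁ := fun h => by simpa using h2 h
      have haY : a ∉ Y₁ := fun h => Finset.disjoint_left.1 hd ha (Finset.mem_of_mem_erase (h2 h))
      have hbX : b ∉ X₁ := fun h => Finset.disjoint_left.1 hd (Finset.mem_of_mem_erase (h1 h)) hb
      refine ⟨insert a X₁, insert b Y₁, ?_, ?_, ?_, ?_, ?_⟩
      · exact Finset.insert_subset ha (h1.trans (Finset.erase_subset _ _))
      · exact Finset.insert_subset hb (h2.trans (Finset.erase_subset _ _))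
      · rw [Finset.card_insert_of_notMem haX, Finset.card_insert_of_notMem hbY, h3]
      · have := Rnd.cons a b _ _ (by simp [haX, haY]) (by simp [hbX, hbY]) hab h4
        convert this using 1
        ext x; simp; tauto
      · intro x hx y hy
        apply h5
        · simp at hx ⊢; tauto
        · simp at hy ⊢; tauto
    · push Not at h
      exact ⟨∅, ∅, by simp, by simp, rfl, by simpa using Rnd.nil, by simpa using h⟩

end Rounds

section Kings
variable {V : Type} {beats : V → V → Prop} [DecidableEq V] [DecidableRel beats]

/-- A player `v` such that all players beating it are beaten by many players beaten by `v`. -/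
theorem superking_wins (hT : IsTournament beats) (v : V) (j : ℕ) : ∀ S : Finset V, v ∈ S →
    S.card = 2 ^ j →
    (∀ u ∈ S, beats u v → j ≤ (S.filter (fun w => beats v w ∧ beats w u)).card) →
    SEWinner beats S v := by
  induction j with
  | zero =>
    intro S hv hS _
    obtain ⟨x, rfl⟩ := Finset.card_eq_one.1 (by simpa using hS)
    have : v = x := by simpa using hv
    subst this
    exact SEWinner.single v
  | succ j ih =>
    intro S hv hS hD
    -- `v` beats someone
    obtain ⟨a, haS, hva⟩ : ∃ a ∈ S, beats v a := by
      by_contra hcon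
      push Not at hcon
      have h2 : 1 < S.card := by rw [hS]; exact Nat.one_lt_two_pow (by omega)
      obtain ⟨u, hu, huv⟩ := Finset.exists_mem_ne h2 v
      have hb : beats u v := by
        rcases hT.total u v huv with h | h
        · exact h
        · exact absurd h (hcon u hu)
      have h3 := hD u hu hb
      have h4 : 0 < (S.filter (fun w => beats v w ∧ beats w u)).card := by omega
      obtain ⟨w, hw⟩ := Finset.card_pos.1 h4
      simp only [Finset.mem_filter] at hw
      exact hcon w hw.1 hw.2.1
    have hav : a ≠ v := by rintro rfl; exact hT.irrefl _ hva
    obtain ⟨X, Y, hX, hY, hXY, hR, hmax⟩ := rnd_matching (beats := beats) _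
      ((S.filter (beats v ·)).erase a) (S.filter (beats · v)) rfl (by
        rw [Finset.disjoint_left]
        intro x hx hx'
        simp only [Finset.mem_erase, Finset.mem_filter] at hx hx'
        exact hT.asymm _ _ hx.2.2 hx'.2)
    have hX' : ∀ x ∈ X, x ∈ S ∧ beats v x ∧ x ≠ a := fun x hx => by
      have := hX hx
      simp only [Finset.mem_erase, Finset.mem_filter] at this
      tauto
    have hY' : ∀ x ∈ Y, x ∈ S ∧ beats x v := fun x hx => by
      have := hY hx
      simpa only [Finset.mem_filter] using this
    have hd1 : Disjoint ({v, a} : Finset V) (X ∪ Y) := by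
      rw [Finset.disjoint_left]
      intro x hx hx'
      simp only [Finset.mem_insert, Finset.mem_singleton, Finset.mem_union] at hx hx'
      rcases hx with rfl | rfl <;> rcases hx' with h | h
      · exact hT.irrefl _ (hX' _ h).2.1
      · exact hT.irrefl _ (hY' _ h).2
      · exact (hX' _ h).2.2 rfl
      · exact hT.asymm _ _ hva (hY' _ h).2
    have hR1 := (Rnd.pair hva).union hR hd1
    set P := ({v, a} : Finset V) ∪ (X ∪ Y) with hP
    have hPS : P ⊆ S := by
      intro x hx
      simp only [hP, Finset.mem_insert, Finset.mem_singleton, Finset.mem_union] at hx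
      rcases hx with (rfl | rfl) | h | h
      · exact hv
      · exact haS
      · exact (hX' _ h).1
      · exact (hY' _ h).1
    have hc1 := hR1.card hT
    have hc2 := Finset.card_sdiff_add_card_eq_card hPS
    obtain ⟨W, hW⟩ := exists_rnd hT (2 ^ j - ({v} ∪ X : Finset V).card) (S \ P) (by
      rw [pow_succ] at hS; omega)
    have hR2 := hR1.union hW Finset.disjoint_sdiff
    rw [Finset.union_sdiff_of_subset hPS] at hR2
    have hc3 := hR2.card hT
    refine hR2.win hT (ih _ (by simp) (by rw [pow_succ] at hS; omega) ?_)
    intro b hb hbv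
    have hbW : b ∈ S \ P := by
      simp only [Finset.mem_union, Finset.mem_singleton] at hb
      rcases hb with (rfl | h) | h
      · exact absurd hbv (hT.irrefl _)
      · exact absurd hbv (hT.asymm _ _ (hX' _ h).2.1)
      · exact hW.sub h
    have hbS := (Finset.mem_sdiff.1 hbW).1
    have hbY : b ∉ Y := fun h => (Finset.mem_sdiff.1 hbW).2 (by simp [hP, h])
    have hDb := hD b hbS hbv
    have hsub : S.filter (fun w => beats v w ∧ beats w b) ⊆
        insert a (({v} ∪ X ∪ W).filter (fun w => beats v w ∧ beats w b)) := by
      intro w hw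
      simp only [Finset.mem_filter] at hw
      by_cases hwa : w = a
      · simp [hwa]
      · by_cases hwX : w ∈ X
        · simp [hwX, hw.2.1, hw.2.2]
        · exact absurd hw.2.2 (hmax w (by simp [hwa, hwX, hw.1, hw.2.1]) b
            (by simp [hbS, hbY, hbv]))
    have h5 := (Finset.card_le_card hsub).trans (Finset.card_insert_le _ _)
    omega

theorem exists_rnd_half (hT : IsTournament beats) (R C : Finset V) (hC : C ⊆ R) (m : ℕ)
    (hR : R.card = 2 * m) : ∃ W, Rnd beats R W ∧ 2 * (W ∩ C).card ≤ C.card + 1 := by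
  have key : ∀ C' : Finset V, C' ⊆ C → C.card ≤ C'.card + 1 → Even C'.card →
      ∃ W, Rnd beats R W ∧ 2 * (W ∩ C).card ≤ C'.card + 2 * (C.card - C'.card) := by
    intro C' hC' hcc he
    obtain ⟨W₁, h1⟩ := exists_rnd_even hT C' he
    have hc := Finset.card_sdiff_add_card_eq_card (hC'.trans hC)
    obtain ⟨W₂, h2⟩ := exists_rnd_even hT (R \ C') (by
      obtain ⟨t, ht⟩ := he
      exact ⟨m - t, by omega⟩)
    refine ⟨W₁ ∪ W₂, ?_, ?_⟩
    · have := h1.union h2 Finset.disjoint_sdiff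
      rwa [Finset.union_sdiff_of_subset (hC'.trans hC)] at this
    · have hs : (W₁ ∪ W₂) ∩ C ⊆ W₁ ∪ (C \ C') := by
        intro x hx
        simp only [Finset.mem_inter, Finset.mem_union, Finset.mem_sdiff] at hx ⊢
        rcases hx with ⟨h | h, hxC⟩
        · exact Or.inl h
        · exact Or.inr ⟨hxC, (Finset.mem_sdiff.1 (h2.sub h)).2⟩
      have h3 := (Finset.card_le_card hs).trans (Finset.card_union_le _ _)
      rw [Finset.card_sdiff_of_subset hC'] at h3
      have h4 := h1.card hT
      omega
  by_cases he : Even C.card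
  · obtain ⟨W, h1, h2⟩ := key C subset_rfl (by omega) he
    exact ⟨W, h1, by omega⟩
  · rw [Nat.not_even_iff_odd] at he
    obtain ⟨t, ht⟩ := he
    obtain ⟨b, hb⟩ : C.Nonempty := by rw [← Finset.card_pos]; omega
    have hcb := Finset.card_erase_of_mem hb
    obtain ⟨W, h1, h2⟩ := key (C.erase b) (Finset.erase_subset _ _) (by omega) ⟨t, by omega⟩
    exact ⟨W, h1, by omega⟩

/-- A king beating at least half of the players wins. -/
theorem bigking_wins (hT : IsTournament beats) (v : V) (j : ℕ) : ∀ S : Finset V, v ∈ S →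
    S.card = 2 ^ j → 2 * (S.filter (beats · v)).card < 2 ^ j →
    (∀ u ∈ S, beats u v → ∃ w ∈ S, beats v w ∧ beats w u) →
    SEWinner beats S v := by
  induction j with
  | zero =>
    intro S hv hS _ _
    obtain ⟨x, rfl⟩ := Finset.card_eq_one.1 (by simpa using hS)
    have : v = x := by simpa using hv
    subst this
    exact SEWinner.single v
  | succ j ih =>
    intro S hv hS hB hD
    have hAB : Disjoint (S.filter (beats v ·)) (S.filter (beats · v)) := by
      rw [Finset.disjoint_left]
      intro x hx hx'
      simp only [Finset.mem_filter] at hx hx'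
      exact hT.asymm _ _ hx.2 hx'.2
    obtain ⟨X, Y, hX, hY, hXY, hR, hmax⟩ := rnd_matching (beats := beats) _
      (S.filter (beats v ·)) (S.filter (beats · v)) rfl hAB
    have hX' : ∀ x ∈ X, x ∈ S ∧ beats v x := fun x hx => by
      have := hX hx
      simpa only [Finset.mem_filter] using this
    have hY' : ∀ x ∈ Y, x ∈ S ∧ beats x v := fun x hx => by
      have := hY hx
      simpa only [Finset.mem_filter] using this
    have hcS : S.card ≤ 1 + (S.filter (beats v ·)).card + (S.filter (beats · v)).card := by
      have : S ⊆ {v} ∪ (S.filter (beats v ·) ∪ S.filter (beats · v)) := by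
        intro x hx
        by_cases hxv : x = v
        · simp [hxv]
        · rcases hT.total x v hxv with h | h <;> simp [hx, h]
      have h1 := (Finset.card_le_card this).trans (Finset.card_union_le _ _)
      have h2 := Finset.card_union_le (S.filter (beats v ·)) (S.filter (beats · v))
      simp only [Finset.card_singleton] at h1
      omega
    have hYc := Finset.card_le_card hY
    obtain ⟨a, ha⟩ : (S.filter (beats v ·) \ X).Nonempty := by
      rw [← Finset.card_pos, Finset.card_sdiff_of_subset hX]
      omega
    have ha' : (a ∈ S ∧ beats v a) ∧ a ∉ X := by simpa using ha
    obtain ⟨⟨haS, hva⟩, haX⟩ := ha'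
    have hd1 : Disjoint ({v, a} : Finset V) (X ∪ Y) := by
      rw [Finset.disjoint_left]
      intro x hx hx'
      simp only [Finset.mem_insert, Finset.mem_singleton, Finset.mem_union] at hx hx'
      rcases hx with rfl | rfl <;> rcases hx' with h | h
      · exact hT.irrefl _ (hX' _ h).2
      · exact hT.irrefl _ (hY' _ h).2
      · exact haX h
      · exact hT.asymm _ _ hva (hY' _ h).2
    have hR1 := (Rnd.pair hva).union hR hd1
    set P := ({v, a} : Finset V) ∪ (X ∪ Y) with hP
    have hPS : P ⊆ S := by
      intro x hx
      simp only [hP, Finset.mem_insert, Finset.mem_singleton, Finset.mem_union] at hx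
      rcases hx with (rfl | rfl) | h | h
      · exact hv
      · exact haS
      · exact (hX' _ h).1
      · exact (hY' _ h).1
    have hc1 := hR1.card hT
    have hc2 := Finset.card_sdiff_add_card_eq_card hPS
    have hCs : S.filter (beats · v) \ Y ⊆ S \ P := by
      intro x hx
      simp only [Finset.mem_sdiff, Finset.mem_filter] at hx
      simp only [hP, Finset.mem_sdiff, Finset.mem_insert, Finset.mem_singleton, Finset.mem_union]
      refine ⟨hx.1.1, ?_⟩
      rintro ((rfl | rfl) | h | h)
      · exact hT.irrefl _ hx.1.2
      · exact hT.asymm _ _ hva hx.1.2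
      · exact hT.asymm _ _ (hX' _ h).2 hx.1.2
      · exact hx.2 h
    obtain ⟨W, hW, hWC⟩ := exists_rnd_half hT (S \ P) _ hCs
      (2 ^ j - ({v} ∪ X : Finset V).card) (by rw [pow_succ] at hS; omega)
    have hR2 := hR1.union hW Finset.disjoint_sdiff
    rw [Finset.union_sdiff_of_subset hPS] at hR2
    have hc3 := hR2.card hT
    have hbW : ∀ b ∈ {v} ∪ X ∪ W, beats b v → b ∈ W ∩ (S.filter (beats · v) \ Y) := by
      intro b hb hbv
      simp only [Finset.mem_union, Finset.mem_singleton] at hb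
      rcases hb with (rfl | h) | h
      · exact absurd hbv (hT.irrefl _)
      · exact absurd hbv (hT.asymm _ _ (hX' _ h).2)
      · have h1 := hW.sub h
        simp only [hP, Finset.mem_sdiff, Finset.mem_union] at h1
        simp only [Finset.mem_inter, Finset.mem_sdiff, Finset.mem_filter]
        tauto
    have hking : ∀ b ∈ {v} ∪ X ∪ W, beats b v → ∃ w ∈ X, beats v w ∧ beats w b := by
      intro b hb hbv
      have h1 := (Finset.mem_inter.1 (hbW b hb hbv)).2
      have h2 := (Finset.mem_filter.1 (Finset.mem_sdiff.1 h1).1)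
      obtain ⟨w, hwS, hvw, hwb⟩ := hD b h2.1 hbv
      refine ⟨w, ?_, hvw, hwb⟩
      by_contra hwX
      exact hmax w (by simp [hwX, hwS, hvw]) b h1 hwb
    refine hR2.win hT (ih _ (by simp) (by rw [pow_succ] at hS; omega) ?_ ?_)
    · have hle : (({v} ∪ X ∪ W).filter (beats · v)).card ≤
          (W ∩ (S.filter (beats · v) \ Y)).card := by
        apply Finset.card_le_card
        intro b hb
        rw [Finset.mem_filter] at hb
        exact hbW b hb.1 hb.2
      rcases Finset.eq_empty_or_nonempty (({v} ∪ X ∪ W).filter (beats · v)) with h0 | ⟨b, hb⟩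
      · rw [h0]; simp
      · rw [Finset.mem_filter] at hb
        obtain ⟨w, hwX, _⟩ := hking b hb.1 hb.2
        have hXpos : 0 < X.card := Finset.card_pos.2 ⟨w, hwX⟩
        rw [Finset.card_sdiff_of_subset hY] at hWC
        rw [pow_succ] at hB
        omega
    · intro b hb hbv
      obtain ⟨w, hwX, h⟩ := hking b hb hbv
      exact ⟨w, by simp [hwX], h⟩

end Kings

section Core
variable {V : Type} {beats : V → V → Prop} [DecidableEq V]

theorem protect (hT : IsTournament beats) (m N : ℕ) (X : Finset V) (D : V → Finset V)
    (F : Finset V) : F.card ≤ N → (∀ b ∈ F, 2 * m * N ≤ (D b ∩ X).card) →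
    ∃ P W, P ⊆ X ∧ Rnd beats P W ∧ P.card ≤ 2 * m * F.card ∧ ∀ b ∈ F, m ≤ (W ∩ D b).card := by
  induction F using Finset.induction_on with
  | empty => intro _ _; exact ⟨∅, ∅, by simp, Rnd.nil, by simp, by simp⟩
  | insert b F hb ih =>
    intro hF hD
    rw [Finset.card_insert_of_notMem hb] at hF ⊢
    obtain ⟨P, W, hP, hR, hc, hW⟩ := ih (by omega) (fun x hx => hD x (by simp [hx]))
    have h1 := hD b (by simp)
    have h2 : 2 * m ≤ ((D b ∩ X) \ P).card := by
      have h3 := Finset.le_card_sdiff P (D b ∩ X)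
      have h4 : 2 * m * (F.card + 1) ≤ 2 * m * N := Nat.mul_le_mul_left _ hF
      rw [mul_add] at h4
      omega
    obtain ⟨T, hTs, hTc⟩ := Finset.exists_subset_card_eq h2
    obtain ⟨Z, hZ⟩ := exists_rnd hT m T hTc
    have hTP : Disjoint P T := by
      rw [Finset.disjoint_right]
      intro x hx
      exact (Finset.mem_sdiff.1 (hTs hx)).2
    have hTX : ∀ x ∈ T, x ∈ D b ∧ x ∈ X := fun x hx =>
      Finset.mem_inter.1 (Finset.mem_sdiff.1 (hTs hx)).1
    refine ⟨P ∪ T, W ∪ Z, ?_, hR.union hZ hTP, ?_, ?_⟩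
    · exact Finset.union_subset hP (fun x hx => (hTX x hx).2)
    · have := Finset.card_union_le P T
      rw [mul_add]
      omega
    · intro x hx
      rcases Finset.mem_insert.1 hx with rfl | hx
      · have h5 := hZ.card hT
        have h6 : Z ⊆ (W ∪ Z) ∩ D x := by
          intro y hy
          have := hTX y (hZ.sub hy)
          simp [hy, this.1]
        have := Finset.card_le_card h6
        omega
      · refine (hW x hx).trans (Finset.card_le_card ?_)
        exact Finset.inter_subset_inter_right Finset.subset_union_left

variable [DecidableRel beats] [Fintype V]

theorem core_wins (hT : IsTournament beats) (v : V) (m : ℕ) (hm : 1 ≤ m)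
    (hcard : Fintype.card V = 2 ^ m) (U : Finset V) (g : V → V)
    (hUv : ∀ u ∈ U, beats u v)
    (hD : ∀ b, beats b v → b ∉ U →
      m ≤ (Finset.univ.filter (fun w => beats v w ∧ beats w b)).card)
    (hg : Set.InjOn g U) (hgb : ∀ u ∈ U, beats (g u) u) (hgv : ∀ u ∈ U, beats (g u) v)
    (hgU : ∀ u ∈ U, g u ∉ U)
    (hgD : ∀ u ∈ U, 2 * m * U.card + m ≤
      (Finset.univ.filter (fun w => beats v w ∧ beats w (g u))).card) :
    SEWinner beats Finset.univ v := by
  obtain ⟨a, hva⟩ : ∃ a, beats v a := by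
    by_contra hcon
    push Not at hcon
    have h2 : 1 < Fintype.card V := by rw [hcard]; exact Nat.one_lt_two_pow (by omega)
    obtain ⟨u, huv⟩ := Fintype.exists_ne_of_one_lt_card h2 v
    have hb : beats u v := by
      rcases hT.total u v huv with h | h
      · exact h
      · exact absurd h (hcon u)
    by_cases huU : u ∈ U
    · have := hgD u huU
      simp [hcon] at this
      omega
    · have := hD u hb huU
      simp [hcon] at this
      omega
  have hav : a ≠ v := by rintro rfl; exact hT.irrefl _ hva
  set G := U.image g with hG
  have hGv : ∀ b ∈ G, beats b v := by
    intro b hb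
    obtain ⟨u, hu, rfl⟩ := Finset.mem_image.1 hb
    exact hgv u hu
  have hUG : Disjoint U G := by
    rw [Finset.disjoint_right]
    intro b hb
    obtain ⟨u, hu, rfl⟩ := Finset.mem_image.1 hb
    exact hgU u hu
  have hR0 := rnd_inj U g hg hgb hUG
  rw [← hG] at hR0
  obtain ⟨X, Y, hX, hY, hXY, hR, hmax⟩ := rnd_matching (beats := beats) _
    ((Finset.univ.filter (beats v ·)).erase a) (Finset.univ.filter (beats · v) \ (U ∪ G)) rfl (by
      rw [Finset.disjoint_left]
      intro x hx hx'
      simp only [Finset.mem_erase, Finset.mem_filter, Finset.mem_sdiff] at hx hx'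
      exact hT.asymm _ _ hx.2.2 hx'.1.2)
  have hX' : ∀ x ∈ X, beats v x ∧ x ≠ a := fun x hx => by
    have := hX hx
    simp only [Finset.mem_erase, Finset.mem_filter] at this
    tauto
  have hY' : ∀ x ∈ Y, beats x v ∧ x ∉ U ∧ x ∉ G := fun x hx => by
    have := hY hx
    simpa using this
  -- the unmatched part of the out-neighbourhood
  set A' := ((Finset.univ.filter (beats v ·)).erase a) \ X with hA'
  have hA'v : ∀ x ∈ A', beats v x ∧ x ≠ a ∧ x ∉ X := by
    intro x hx
    simp only [hA', Finset.mem_sdiff, Finset.mem_erase, Finset.mem_filter] at hx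
    tauto
  set D : V → Finset V := fun b => Finset.univ.filter (fun w => beats v w ∧ beats w b) with hDdef
  set F := G.filter (fun b => 2 * m * G.card ≤ (D b ∩ A').card) with hF
  obtain ⟨Q, Z, hQ, hRQ, -, hZ⟩ := protect hT m G.card A' D F
    (Finset.card_le_card (Finset.filter_subset _ _)) (fun b hb => (Finset.mem_filter.1 hb).2)
  have hUG' : ∀ x ∈ U ∪ G, beats x v := by
    intro x hx
    rcases Finset.mem_union.1 hx with h | h
    · exact hUv x h
    · exact hGv x h
  have hd1 : Disjoint ({v, a} : Finset V) (X ∪ Y) := by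
    rw [Finset.disjoint_left]
    intro x hx hx'
    simp only [Finset.mem_insert, Finset.mem_singleton, Finset.mem_union] at hx hx'
    rcases hx with rfl | rfl <;> rcases hx' with h | h
    · exact hT.irrefl _ (hX' _ h).1
    · exact hT.irrefl _ (hY' _ h).1
    · exact (hX' _ h).2 rfl
    · exact hT.asymm _ _ hva (hY' _ h).1
  have hR1 := (Rnd.pair hva).union hR hd1
  have hd2 : Disjoint (({v, a} : Finset V) ∪ (X ∪ Y)) (U ∪ G) := by
    rw [Finset.disjoint_left]
    intro x hx hx'
    have h0 := hUG' x hx'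
    simp only [Finset.mem_insert, Finset.mem_singleton, Finset.mem_union] at hx hx'
    rcases hx with (rfl | rfl) | h | h
    · exact hT.irrefl _ h0
    · exact hT.asymm _ _ hva h0
    · exact hT.asymm _ _ (hX' _ h).1 h0
    · have := hY' _ h
      tauto
  have hR2 := hR1.union hR0 hd2
  have hd3 : Disjoint ((({v, a} : Finset V) ∪ (X ∪ Y)) ∪ (U ∪ G)) Q := by
    rw [Finset.disjoint_right]
    intro x hx hx'
    have h0 := hA'v x (hQ hx)
    rcases Finset.mem_union.1 hx' with h | h
    · simp only [Finset.mem_insert, Finset.mem_singleton, Finset.mem_union] at h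
      rcases h with (rfl | rfl) | h | h
      · exact hT.irrefl _ h0.1
      · exact h0.2.1 rfl
      · exact h0.2.2 h
      · exact hT.asymm _ _ h0.1 (hY' _ h).1
    · exact hT.asymm _ _ h0.1 (hUG' _ h)
  have hR3 := hR2.union hRQ hd3
  set P := ((({v, a} : Finset V) ∪ (X ∪ Y)) ∪ (U ∪ G)) ∪ Q with hP
  have hc1 := hR3.card hT
  have hc2 := Finset.card_sdiff_add_card_eq_card (Finset.subset_univ P)
  rw [Finset.card_univ, hcard] at hc2
  obtain ⟨j, rfl⟩ : ∃ j, m = j + 1 := ⟨m - 1, by omega⟩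
  rw [pow_succ] at hc2
  obtain ⟨W, hW⟩ := exists_rnd hT (2 ^ j - ({v} ∪ X ∪ G ∪ Z : Finset V).card)
    (Finset.univ \ P) (by omega)
  have hR4 := hR3.union hW Finset.disjoint_sdiff
  rw [Finset.union_sdiff_of_subset (Finset.subset_univ P)] at hR4
  have hc3 := hR4.card hT
  rw [Finset.card_univ, hcard, pow_succ] at hc3
  refine hR4.win hT (superking_wins hT v j _ (by simp) (by omega) ?_)
  intro b hb hbv
  by_cases hbG : b ∈ G
  · by_cases hbF : b ∈ F
    · have h1 := hZ b hbF
      have h2 : Z ∩ D b ⊆ ({v} ∪ X ∪ G ∪ Z ∪ W).filter (fun w => beats v w ∧ beats w b) := by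
        intro w hw
        simp only [hDdef, Finset.mem_inter, Finset.mem_filter] at hw
        simp [hw.1, hw.2.2.1, hw.2.2.2]
      have := Finset.card_le_card h2
      omega
    · have h1 : (D b ∩ A').card < 2 * (j + 1) * G.card := by
        simp only [hF, Finset.mem_filter, not_and, not_le] at hbF
        exact hbF hbG
      have h2 : 2 * (j + 1) * U.card + (j + 1) ≤ (D b).card := by
        obtain ⟨u, hu, rfl⟩ := Finset.mem_image.1 hbG
        exact hgD u hu
      have h3 : G.card = U.card := Finset.card_image_of_injOn hg
      have h4 : D b ⊆ insert a (({v} ∪ X ∪ G ∪ Z ∪ W).filter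
          (fun w => beats v w ∧ beats w b) ∪ (D b ∩ A')) := by
        intro w hw
        have hw' : beats v w ∧ beats w b := by simpa [hDdef] using hw
        by_cases hwa : w = a
        · simp [hwa]
        · by_cases hwX : w ∈ X
          · simp [hwX, hw'.1, hw'.2]
          · have : w ∈ A' := by simp [hA', hwa, hwX, hw'.1]
            simp [hw, this]
      have h5 := (Finset.card_le_card h4).trans (Finset.card_insert_le _ _)
      have h6 := Finset.card_union_le (({v} ∪ X ∪ G ∪ Z ∪ W).filter
          (fun w => beats v w ∧ beats w b)) (D b ∩ A')
      rw [h3] at h1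
      omega
  · have hbW : b ∈ Finset.univ \ P := by
      simp only [Finset.mem_union, Finset.mem_singleton] at hb
      rcases hb with (((rfl | h) | h) | h) | h
      · exact absurd hbv (hT.irrefl _)
      · exact absurd hbv (hT.asymm _ _ (hX' _ h).1)
      · exact absurd h hbG
      · exact absurd hbv (hT.asymm _ _ (hA'v _ (hQ (hRQ.sub h))).1)
      · exact hW.sub h
    have hbP := (Finset.mem_sdiff.1 hbW).2
    have hbU : b ∉ U := fun h => hbP (by simp [hP, h])
    have hbY : b ∉ Y := fun h => hbP (by simp [hP, h])
    have hDb := hD b hbv hbU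
    have hsub : D b ⊆
        insert a (({v} ∪ X ∪ G ∪ Z ∪ W).filter (fun w => beats v w ∧ beats w b)) := by
      intro w hw
      have hw' : beats v w ∧ beats w b := by simpa [hDdef] using hw
      by_cases hwa : w = a
      · simp [hwa]
      · by_cases hwX : w ∈ X
        · simp [hwX, hw'.1, hw'.2]
        · exact absurd hw'.2 (hmax w (by simp [hA', hwa, hwX, hw'.1]) b
            (by simp [hbU, hbG, hbY, hbv]))
    have h5 := (Finset.card_le_card hsub).trans (Finset.card_insert_le _ _)
    have hDb' : j + 1 ≤ (D b).card := hDb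
    omega

end Core

section Count
variable {V : Type} {beats : V → V → Prop}

theorem chain_insert (hT : IsTournament beats) (a : V) (l : List V) : l.IsChain beats → a ∉ l →
    ∃ l' : List V, l'.Perm (a :: l) ∧ l'.IsChain beats ∧
      ∀ x ∈ l'.head?, x = a ∨ x ∈ l.head? := by
  induction l with
  | nil => intro _ _; exact ⟨[a], by simp, by simp, by simp⟩
  | cons b l ih =>
    intro hl ha
    simp only [List.mem_cons, not_or] at ha
    rcases hT.total a b ha.1 with h | h
    · exact ⟨a :: b :: l, List.Perm.refl _, List.isChain_cons_cons.2 ⟨h, hl⟩, by simp⟩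
    · rw [List.isChain_cons] at hl
      obtain ⟨l', h1, h2, h3⟩ := ih hl.2 ha.2
      refine ⟨b :: l', ?_, ?_, by simp⟩
      · exact (h1.cons b).trans (List.Perm.swap _ _ _)
      · rw [List.isChain_cons]
        refine ⟨?_, h2⟩
        intro y hy
        rcases h3 y hy with rfl | h'
        · exact h
        · exact hl.1 y h'

variable [DecidableEq V]

theorem redei (hT : IsTournament beats) (E : Finset V) :
    ∃ l : List V, l.Nodup ∧ l.toFinset = E ∧ l.IsChain beats := by
  induction E using Finset.induction_on with
  | empty => exact ⟨[], by simp, by simp, by simp⟩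
  | insert a E ha ih =>
    obtain ⟨l, h1, h2, h3⟩ := ih
    have hal : a ∉ l := by rw [← List.mem_toFinset, h2]; exact ha
    obtain ⟨l', h4, h5, -⟩ := chain_insert hT a l h3 hal
    refine ⟨l', ?_, ?_, h5⟩
    · rw [h4.nodup_iff]; simp [h1, hal]
    · rw [List.toFinset_eq_of_perm _ _ h4]; simp [h2]

variable [Fintype V]

open Classical in
/-- injective directed sequences of length `j` inside `E` -/
noncomputable def hamSet (beats : V → V → Prop) (E : Finset V) (j : ℕ) : Finset (Fin j → V) :=
  Finset.univ.filter (fun s => Function.Injective s ∧ (∀ i, s i ∈ E) ∧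
    ∀ i i' : Fin j, i'.val = i.val + 1 → beats (s i) (s i'))

theorem choose_le_hamSet (hT : IsTournament beats) (E : Finset V) (j : ℕ) :
    E.card.choose j ≤ (hamSet beats E j).card := by
  rw [← Finset.card_powersetCard]
  apply Finset.card_le_card_of_surjOn (fun s => Finset.univ.image s)
  intro C hC
  have hC' : C ⊆ E ∧ C.card = j := by simpa [Finset.mem_powersetCard] using hC
  obtain ⟨l, h1, h2, h3⟩ := redei hT C
  have hlen : l.length = j := by
    rw [← hC'.2, ← h2, List.toFinset_card_of_nodup h1]
  subst hlen
  refine ⟨l.get, ?_, ?_⟩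
  · simp only [hamSet, Finset.coe_filter, Finset.mem_univ, true_and, Set.mem_ofPred_eq]
    refine ⟨List.nodup_iff_injective_get.1 h1, ?_, ?_⟩
    · intro i
      apply hC'.1
      rw [← h2, List.mem_toFinset]
      exact List.get_mem _ _
    · intro i i' hi
      have := List.isChain_iff_getElem.1 h3 i.val (by omega)
      simp only [List.get_eq_getElem]
      simpa only [hi] using this
  · ext x
    simp only [Finset.mem_image, Finset.mem_univ, true_and, ← h2, List.mem_toFinset]
    exact List.mem_iff_get.symm

open Classical in
/-- tails of the `(j+1)`-paths originating at `v` -/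
noncomputable def tails (beats : V → V → Prop) (j : ℕ) (v : V) : Finset (Fin (j + 1) → V) :=
  Finset.univ.filter (fun s => Function.Injective s ∧ (∀ i, s i ≠ v) ∧ beats v (s 0) ∧
    ∀ i i' : Fin (j + 1), i'.val = i.val + 1 → beats (s i) (s i'))

theorem mem_tails {j : ℕ} {v : V} {s : Fin (j + 1) → V} : s ∈ tails beats j v ↔
    (Function.Injective s ∧ (∀ i, s i ≠ v) ∧ beats v (s 0) ∧
    ∀ i i' : Fin (j + 1), i'.val = i.val + 1 → beats (s i) (s i')) := by
  simp [tails]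

theorem kPathCount_eq (j : ℕ) (v : V) : kPathCount beats (j + 1) v = (tails beats j v).card := by
  rw [kPathCount, ← Set.ncard_coe_finset,
    ← Set.ncard_image_of_injective (tails beats j v : Set (Fin (j + 1) → V))
      (Fin.cons_right_injective (α := fun _ => V) v)]
  congr 1
  ext p
  simp only [Set.mem_ofPred_eq, Set.mem_image, Finset.mem_coe, mem_tails]
  constructor
  · rintro ⟨h1, h2, h3⟩
    refine ⟨Fin.tail p, ⟨?_, ?_, ?_, ?_⟩, ?_⟩
    · exact fun a b h => Fin.succ_injective _ (h1 h)
    · intro i h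
      rw [← h2] at h
      exact Fin.succ_ne_zero i (h1 h)
    · have := h3 0
      simpa [h2, Fin.tail] using this
    · intro i i' h
      have h5 := h3 i'
      have e : i'.castSucc = i.succ := by ext; simp [h]
      rw [e] at h5
      exact h5
    · rw [← h2]; exact Fin.cons_self_tail p
  · rintro ⟨s, ⟨h1, h2, h3, h4⟩, rfl⟩
    refine ⟨?_, by simp, ?_⟩
    · rw [Fin.cons_injective_iff]
      exact ⟨by rintro ⟨i, hi⟩; exact h2 i hi, h1⟩
    · intro i
      refine Fin.cases ?_ (fun i => ?_) i
      · simpa using h3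
      · have e : i.succ.castSucc = i.castSucc.succ := by ext; simp
        have h5 := h4 i.castSucc i.succ (by simp)
        rw [e]
        simpa using h5

/-- number of functions with a prescribed coordinate -/
theorem card_coord (j : ℕ) (i : Fin (j + 1)) (X : Finset V) :
    (Finset.univ.filter (fun t : Fin (j + 1) → V => t i ∈ X)).card
      = X.card * Fintype.card V ^ j := by
  have : (Finset.univ.filter (fun t : Fin (j + 1) → V => t i ∈ X)) =
      Fintype.piFinset (fun i' => if i' = i then X else Finset.univ) := by
    ext t
    simp only [Finset.mem_filter, Finset.mem_univ, true_and, Fintype.mem_piFinset]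
    constructor
    · intro h i'
      by_cases hi : i' = i
      · subst hi; simpa using h
      · simp [hi]
    · intro h
      simpa using h i
  rw [this, Fintype.card_piFinset, ← Finset.mul_prod_erase _ _ (Finset.mem_univ i)]
  congr 1
  · simp
  · rw [Finset.prod_congr rfl (g := fun _ => Fintype.card V)]
    · simp
    · intro x hx
      simp [Finset.ne_of_mem_erase hx]

theorem card_two_coord (j : ℕ) (i i' : Fin (j + 1)) (hi : i ≠ i') (X : Finset V) (u : V) :
    (Finset.univ.filter (fun t : Fin (j + 1) → V => t i ∈ X ∧ t i' = u)).card * Fintype.card V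
      ≤ X.card * Fintype.card V ^ j := by
  rw [← card_coord j i X, ← Finset.card_univ, ← Finset.card_product]
  apply Finset.card_le_card_of_injOn (fun q => Function.update q.1 i' q.2)
  · rintro ⟨t, x⟩ h
    simp only [Finset.coe_product, Set.mem_prod, Finset.mem_coe, Finset.mem_filter] at h
    simp [Function.update_of_ne hi, h.1.2.1]
  · rintro ⟨t, x⟩ h ⟨t', x'⟩ h' heq
    simp only [Finset.coe_product, Set.mem_prod, Finset.mem_coe, Finset.mem_filter] at h h'
    simp only at heq
    have hx : x = x' := by simpa using congrFun heq i'
    have ht : t = t' := by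
      funext l
      by_cases hl : l = i'
      · rw [hl, h.1.2.2, h'.1.2.2]
      · simpa [Function.update_of_ne hl] using congrFun heq l
    rw [hx, ht]

variable [DecidableRel beats]

/-- First comparison: from `P(u) ≤ P(v)` deduce a bound on the out-neighbourhood of `u` among the
players beating `v`. -/
theorem count_one (hT : IsTournament beats) (j : ℕ) (u v : V) (huv : beats u v)
    (hle : (tails beats j u).card ≤ (tails beats j v).card) :
    (Finset.univ.filter (fun w => beats w v ∧ beats u w)).card.choose (j + 1) ≤
      ((j + 1) + (Finset.univ.filter (fun w => beats v w ∧ beats w u)).card)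
        * Fintype.card V ^ j := by
  set E := Finset.univ.filter (fun w => beats w v ∧ beats u w) with hE
  set D := Finset.univ.filter (fun w => beats v w ∧ beats w u) with hD
  have hne : u ≠ v := by rintro rfl; exact hT.irrefl _ huv
  have h1 : tails beats j v ⊆ (tails beats j u).filter (fun t => beats v (t 0)) ∪
      ((Finset.univ.biUnion fun i : Fin (j + 1) =>
        Finset.univ.filter (fun t : Fin (j + 1) → V => t i ∈ ({u} : Finset V))) ∪
      Finset.univ.filter (fun t : Fin (j + 1) → V => t 0 ∈ D)) := by
    intro t ht
    have ht' := mem_tails.1 ht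
    by_cases hu : ∃ i, t i = u
    · obtain ⟨i, hi⟩ := hu
      apply Finset.mem_union_right
      apply Finset.mem_union_left
      simp only [Finset.mem_biUnion, Finset.mem_filter, Finset.mem_univ, true_and,
        Finset.mem_singleton]
      exact ⟨i, hi⟩
    · push Not at hu
      rcases hT.total u (t 0) (hu 0).symm with h | h
      · apply Finset.mem_union_left
        rw [Finset.mem_filter, mem_tails]
        exact ⟨⟨ht'.1, hu, h, ht'.2.2.2⟩, ht'.2.2.1⟩
      · apply Finset.mem_union_right
        apply Finset.mem_union_right
        simp only [hD, Finset.mem_filter, Finset.mem_univ, true_and]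
        exact ⟨ht'.2.2.1, h⟩
  have h2 : hamSet beats E (j + 1) ⊆
      (tails beats j u).filter (fun t => ¬ beats v (t 0)) := by
    intro s hs
    simp only [hamSet, Finset.mem_filter, Finset.mem_univ, true_and] at hs
    have hsE : ∀ i, beats (s i) v ∧ beats u (s i) := fun i => by
      simpa [hE] using hs.2.1 i
    rw [Finset.mem_filter, mem_tails]
    refine ⟨⟨hs.1, ?_, (hsE 0).2, hs.2.2⟩, hT.asymm _ _ (hsE 0).1⟩
    intro i h
    have := (hsE i).2
    rw [h] at this
    exact hT.irrefl _ this
  have h3 := Finset.card_filter_add_card_filter_not (s := tails beats j u)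
    (fun t => beats v (t 0))
  have h4 := choose_le_hamSet hT E (j + 1)
  have h5 := Finset.card_le_card h2
  have h6 := (Finset.card_le_card h1).trans (Finset.card_union_le _ _)
  have h7 := Finset.card_union_le (Finset.univ.biUnion fun i : Fin (j + 1) =>
        Finset.univ.filter (fun t : Fin (j + 1) → V => t i ∈ ({u} : Finset V)))
      (Finset.univ.filter (fun t : Fin (j + 1) → V => t 0 ∈ D))
  have h8 : (Finset.univ.biUnion fun i : Fin (j + 1) =>
        Finset.univ.filter (fun t : Fin (j + 1) → V => t i ∈ ({u} : Finset V))).card ≤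
        (j + 1) * Fintype.card V ^ j := by
    refine Finset.card_biUnion_le.trans ?_
    rw [Finset.sum_congr rfl (fun i _ => card_coord j i {u})]
    simp
  rw [card_coord j 0 D] at h7
  rw [add_mul]
  omega

/-- Second comparison: if no player beaten by `v` beats `u`. -/
theorem count_two (hT : IsTournament beats) (j : ℕ) (u v : V) (huv : beats u v)
    (hle : (tails beats j u).card ≤ (tails beats j v).card)
    (hD : ∀ w, beats v w → ¬ beats w u) :
    (Finset.univ.filter (fun w => beats v w)).card.choose j * Fintype.card V ≤
      j * (Finset.univ.filter (fun w => beats w v)).card * Fintype.card V ^ j := by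
  set A := Finset.univ.filter (fun w => beats v w) with hA
  set B := Finset.univ.filter (fun w => beats w v) with hB
  have hne : u ≠ v := by rintro rfl; exact hT.irrefl _ huv
  set X := (Finset.univ.biUnion fun i : Fin j => Finset.univ.filter
    (fun t : Fin (j + 1) → V => t i.castSucc ∈ B ∧ t i.succ = u)) with hX
  have h1 : tails beats j v ⊆ (tails beats j u).filter (fun t => t 0 ≠ v) ∪ X := by
    intro t ht
    have ht' := mem_tails.1 ht
    by_cases hu : ∃ i, t i = u
    · obtain ⟨i, hi⟩ := hu
      apply Finset.mem_union_right
      induction i using Fin.cases with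
      | zero =>
        exfalso
        have := ht'.2.2.1
        rw [hi] at this
        exact hT.asymm _ _ huv this
      | succ i =>
        simp only [hX, hB, Finset.mem_biUnion, Finset.mem_filter, Finset.mem_univ, true_and]
        refine ⟨i, ?_, hi⟩
        have h2 := ht'.2.2.2 i.castSucc i.succ (by simp)
        rw [hi] at h2
        rcases hT.total _ _ (ht'.2.1 i.castSucc) with h | h
        · exact h
        · exact absurd h2 (hD _ h)
    · push Not at hu
      rcases hT.total u (t 0) (hu 0).symm with h | h
      · apply Finset.mem_union_left
        rw [Finset.mem_filter, mem_tails]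
        exact ⟨⟨ht'.1, hu, h, ht'.2.2.2⟩, ht'.2.1 0⟩
      · exact absurd h (hD _ ht'.2.2.1)
  have h2 : (hamSet beats A j).image (Fin.cons (α := fun _ => V) v) ⊆
      (tails beats j u).filter (fun t => ¬ t 0 ≠ v) := by
    intro t ht
    obtain ⟨s, hs, rfl⟩ := Finset.mem_image.1 ht
    simp only [hamSet, Finset.mem_filter, Finset.mem_univ, true_and] at hs
    have hsA : ∀ i, beats v (s i) := fun i => by
      simpa [hA] using hs.2.1 i
    rw [Finset.mem_filter, mem_tails]
    refine ⟨⟨?_, ?_, ?_, ?_⟩, by simp⟩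
    · rw [Fin.cons_injective_iff]
      refine ⟨?_, hs.1⟩
      rintro ⟨i, hi⟩
      have := hsA i
      rw [hi] at this
      exact hT.irrefl _ this
    · intro i
      induction i using Fin.cases with
      | zero => simpa using hne.symm
      | succ i =>
        simp only [Fin.cons_succ]
        intro h
        have := hsA i
        rw [h] at this
        exact hT.asymm _ _ huv this
    · simpa using huv
    · intro i i' h
      induction i' using Fin.cases with
      | zero => simp at h
      | succ i' =>
        induction i using Fin.cases with
        | zero => simpa using hsA i'
        | succ i =>
          simp only [Fin.cons_succ]
          exact hs.2.2 i i' (by simpa using h)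
  have h3 := Finset.card_filter_add_card_filter_not (s := tails beats j u)
    (fun t => t 0 ≠ v)
  have h4 := choose_le_hamSet hT A j
  have h5 := Finset.card_le_card h2
  rw [Finset.card_image_of_injective _ (Fin.cons_right_injective (α := fun _ => V) v)] at h5
  have h6 := (Finset.card_le_card h1).trans (Finset.card_union_le _ _)
  have h8 : X.card * Fintype.card V ≤ j * B.card * Fintype.card V ^ j := by
    refine (Nat.mul_le_mul_right _ Finset.card_biUnion_le).trans ?_
    rw [Finset.sum_mul]
    refine (Finset.sum_le_sum (fun i _ => card_two_coord j i.castSucc i.succ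
      (by simp [Fin.ext_iff]) B u)).trans ?_
    simp [mul_assoc]
  refine le_trans (Nat.mul_le_mul_right _ ?_) h8
  omega

end Count

section Final

theorem choose_lb (n r e k : ℕ) (h : n ≤ r * (e + 1 - k)) :
    n ^ k ≤ r ^ k * (k.factorial * e.choose k) := by
  rw [← Nat.descFactorial_eq_factorial_mul_choose]
  calc n ^ k ≤ (r * (e + 1 - k)) ^ k := Nat.pow_le_pow_left h k
    _ = r ^ k * (e + 1 - k) ^ k := mul_pow _ _ _
    _ ≤ _ := Nat.mul_le_mul_left _ (Nat.pow_sub_le_descFactorial e k)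

theorem card_le_of_outdeg {V : Type} {beats : V → V → Prop} [DecidableEq V] [DecidableRel beats]
    (hT : IsTournament beats) (U : Finset V) (e : ℕ)
    (h : ∀ u ∈ U, (U.filter (fun w => beats u w)).card ≤ e) : U.card ≤ 2 * e + 1 := by
  rcases Finset.eq_empty_or_nonempty U with rfl | hU
  · simp
  have h1 : ∀ u ∈ U, U.card ≤ 1 + (U.filter (fun w => beats u w)).card
      + (U.filter (fun w => beats w u)).card := by
    intro u hu
    have : U ⊆ {u} ∪ (U.filter (fun w => beats u w) ∪ U.filter (fun w => beats w u)) := by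
      intro x hx
      by_cases hxv : x = u
      · simp [hxv]
      · rcases hT.total x u hxv with h | h <;> simp [hx, h]
    have h1 := (Finset.card_le_card this).trans (Finset.card_union_le _ _)
    have h2 := Finset.card_union_le (U.filter (fun w => beats u w)) (U.filter (fun w => beats w u))
    simp only [Finset.card_singleton] at h1
    omega
  have h2 := Finset.sum_le_sum h1
  have h3 : ∑ u ∈ U, (U.filter (fun w => beats u w)).card
      = ∑ u ∈ U, (U.filter (fun w => beats w u)).card :=
    Finset.sum_card_bipartiteAbove_eq_sum_card_bipartiteBelow beats
  have h4 := Finset.sum_le_sum h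
  simp only [Finset.sum_add_distrib, Finset.sum_const, smul_eq_mul, mul_one] at h2 h4
  rw [← h3] at h2
  have h5 : 0 < U.card := Finset.card_pos.2 hU
  refine Nat.le_of_mul_le_mul_left (a := U.card) ?_ h5
  rw [mul_add]
  nlinarith

theorem eventually_big (K d : ℕ) : ∃ M : ℕ, ∀ m, M ≤ m → K * m ^ d < 2 ^ m := by
  have h := tendsto_pow_const_div_const_pow_of_one_lt d (one_lt_two : (1 : ℝ) < 2)
  have h2 : ∀ᶠ m : ℕ in Filter.atTop, (m : ℝ) ^ d / 2 ^ m < 1 / (K + 1) :=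
    h.eventually_lt_const (by positivity)
  obtain ⟨M, hM⟩ := Filter.eventually_atTop.1 h2
  refine ⟨M, fun m hm => ?_⟩
  have h3 := hM m hm
  rw [div_lt_div_iff₀ (by positivity) (by positivity)] at h3
  have h4 : (0 : ℝ) ≤ (m : ℝ) ^ d := by positivity
  have h5 : (K : ℝ) * (m : ℝ) ^ d < 2 ^ m := by nlinarith
  exact_mod_cast h5

/-- The main argument, with explicit largeness hypotheses. -/
theorem main_case {V : Type} [Fintype V] [DecidableEq V] {beats : V → V → Prop}
    [DecidableRel beats] (hT : IsTournament beats) (j m c q n : ℕ) (hm : 1 ≤ m)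
    (hn : n = 2 ^ m) (hcard : Fintype.card V = n)
    (hc : c = 4 ^ (j + 1) * (j + 1).factorial)
    (hq : q = 2 * (16 * c) ^ (j + 1) * (j + 1).factorial + 1)
    (H1 : (16 * q * m) ^ (j + 1) * ((j + 1).factorial * ((j + 1) + m)) < n)
    (H2 : 16 * q * (j + 1) * m ≤ n)
    (v : V) (hv : ∀ u, (tails beats j u).card ≤ (tails beats j v).card) :
    SEWinner beats Finset.univ v := by
  have hfac : 1 ≤ (j + 1).factorial := Nat.factorial_pos _
  have hc4 : 4 ≤ c := by
    rw [hc, pow_succ]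
    have : 1 ≤ 4 ^ j := Nat.one_le_pow _ _ (by norm_num)
    nlinarith
  have hqc : 16 * c ≤ q := by
    have h1 : 16 * c ≤ (16 * c) ^ (j + 1) := Nat.le_self_pow (by omega) _
    have h2 : (16 * c) ^ (j + 1) * 1 ≤ (16 * c) ^ (j + 1) * (j + 1).factorial :=
      Nat.mul_le_mul_left _ hfac
    rw [hq, mul_assoc]
    omega
  have hqm : 16 * (q * m) ≤ n := by
    have : 16 * (q * m) * 1 ≤ 16 * (q * m) * (j + 1) := Nat.mul_le_mul_left _ (by omega)
    calc 16 * (q * m) ≤ 16 * (q * m) * (j + 1) := by omega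
      _ = 16 * q * (j + 1) * m := by ring
      _ ≤ n := H2
  have hqk : 16 * (q * (j + 1)) ≤ n := by
    have : 16 * (q * (j + 1)) * 1 ≤ 16 * (q * (j + 1)) * m := Nat.mul_le_mul_left _ (by omega)
    calc 16 * (q * (j + 1)) ≤ 16 * (q * (j + 1)) * m := by omega
      _ = 16 * q * (j + 1) * m := by ring
      _ ≤ n := H2
  have hck : 16 * c * (j + 1) ≤ q * (j + 1) := Nat.mul_le_mul_right _ hqc
  have hck4 : 4 * (j + 1) ≤ c * (j + 1) := Nat.mul_le_mul_right _ hc4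
  have hck5 : 16 * c * (j + 1) = 16 * (c * (j + 1)) := by ring
  have hqq : q * 1 ≤ q * (j + 1) := Nat.mul_le_mul_left _ (by omega)
  have hqq' : q * 1 ≤ q * m := Nat.mul_le_mul_left _ hm
  have hn0 : 0 < n := by omega
  set A := Finset.univ.filter (fun w => beats v w) with hA
  set B := Finset.univ.filter (fun w => beats w v) with hB
  set E : V → Finset V := fun u => Finset.univ.filter (fun w => beats w v ∧ beats u w) with hE
  set D : V → Finset V := fun u => Finset.univ.filter (fun w => beats v w ∧ beats w u) with hD
  have hAB : n ≤ 1 + A.card + B.card := by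
    have : (Finset.univ : Finset V) ⊆ {v} ∪ (A ∪ B) := by
      intro x hx
      by_cases hxv : x = v
      · simp [hxv]
      · rcases hT.total x v hxv with h | h <;> simp [hA, hB, h]
    have h1 := (Finset.card_le_card this).trans (Finset.card_union_le _ _)
    have h2 := Finset.card_union_le A B
    rw [Finset.card_univ, hcard, Finset.card_singleton] at h1
    omega
  by_cases hBc : c * B.card < n
  · -- few players beat `v`
    have hB4 : 4 * B.card < n := lt_of_le_of_lt (Nat.mul_le_mul_right _ hc4) hBc
    refine bigking_wins hT v m _ (Finset.mem_univ v) (by rw [Finset.card_univ, hcard, hn])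
      (by rw [← hn]; change 2 * B.card < n; omega) ?_
    intro u _ huv
    by_contra hcon
    have hD0 : ∀ w, beats v w → ¬ beats w u := fun w h1 h2 =>
      hcon ⟨w, Finset.mem_univ w, h1, h2⟩
    have h1 := count_two hT j u v huv (hv u) hD0
    rw [hcard] at h1
    change A.card.choose j * n ≤ j * B.card * n ^ j at h1
    have h2 := choose_lb n 4 A.card j (by omega)
    have h3 : n ^ j * n ≤ n ^ j * (4 ^ j * (j.factorial * j) * B.card) := by
      calc n ^ j * n ≤ 4 ^ j * (j.factorial * A.card.choose j) * n := Nat.mul_le_mul_right _ h2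
        _ = 4 ^ j * j.factorial * (A.card.choose j * n) := by ring
        _ ≤ 4 ^ j * j.factorial * (j * B.card * n ^ j) := Nat.mul_le_mul_left _ h1
        _ = _ := by ring
    have h4 := Nat.le_of_mul_le_mul_left h3 (by positivity)
    have h5 : 4 ^ j * (j.factorial * j) ≤ c := by
      rw [hc, Nat.factorial_succ, pow_succ]
      have : j.factorial * j ≤ (j + 1) * j.factorial := by
        rw [mul_comm]; exact Nat.mul_le_mul_right _ (by omega)
      calc 4 ^ j * (j.factorial * j) ≤ 4 ^ j * ((j + 1) * j.factorial) :=
            Nat.mul_le_mul_left _ this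
        _ ≤ 4 ^ j * 4 * ((j + 1) * j.factorial) := Nat.mul_le_mul_right _ (by omega)
    have h6 := Nat.mul_le_mul_right B.card h5
    omega
  · -- many players beat `v`
    push Not at hBc
    have key : ∀ u, beats u v → (E u).card.choose (j + 1) ≤ ((j + 1) + (D u).card) * n ^ j := by
      intro u huv
      have := count_one hT j u v huv (hv u)
      rwa [hcard] at this
    set U₂ := B.filter (fun u => q * (D u).card < n) with hU₂
    set U := B.filter (fun u => (D u).card < m) with hU
    have hBv : ∀ u, u ∈ B ↔ beats u v := fun u => by simp [hB]
    have hU₂E : ∀ u ∈ U₂, 8 * c * (E u).card < n := by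
      intro u hu
      rw [hU₂, Finset.mem_filter, hBv] at hu
      by_contra hcon
      push Not at hcon
      have h0 : n ≤ 16 * c * ((E u).card + 1 - (j + 1)) := by
        have : 16 * c * ((E u).card + 1 - (j + 1)) = 16 * c * (E u).card - 16 * c * j := by
          rw [← Nat.mul_sub]; congr 1; omega
        rw [this]
        have h' : 16 * c * j ≤ 16 * c * (j + 1) := Nat.mul_le_mul_left _ (by omega)
        have h'' : 16 * c * (E u).card = 2 * (8 * c * (E u).card) := by ring
        omega
      have h1 := choose_lb n (16 * c) _ (j + 1) h0
      have h2 := key u hu.1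
      have h3 : q * (E u).card.choose (j + 1) ≤ 2 * n ^ (j + 1) := by
        calc q * (E u).card.choose (j + 1) ≤ q * (((j + 1) + (D u).card) * n ^ j) :=
              Nat.mul_le_mul_left _ h2
          _ = (q * (j + 1) + q * (D u).card) * n ^ j := by ring
          _ ≤ (2 * n) * n ^ j := Nat.mul_le_mul_right _ (by omega)
          _ = _ := by ring
      have h4 : 0 < n ^ (j + 1) := by positivity
      have h5 : 0 < (E u).card.choose (j + 1) := by
        rcases Nat.eq_zero_or_pos ((E u).card.choose (j + 1)) with h | h
        · rw [h] at h1; simp at h1; omega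
        · exact h
      rw [hq] at h3
      nlinarith
    have hUE : ∀ u ∈ U, 8 * (q * m) * (E u).card < n := by
      intro u hu
      rw [hU, Finset.mem_filter, hBv] at hu
      by_contra hcon
      push Not at hcon
      have h0 : n ≤ 16 * q * m * ((E u).card + 1 - (j + 1)) := by
        have : 16 * q * m * ((E u).card + 1 - (j + 1))
            = 16 * q * m * (E u).card - 16 * q * m * j := by
          rw [← Nat.mul_sub]; congr 1; omega
        rw [this]
        have h' : 16 * q * m * j + 16 * q * m = 16 * q * (j + 1) * m := by ring
        have h'' : 16 * q * m * (E u).card = 2 * (8 * (q * m) * (E u).card) := by ring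
        omega
      have h1 := choose_lb n (16 * q * m) _ (j + 1) h0
      have h2 := key u hu.1
      have h3 : n ^ j * n ≤ n ^ j * ((16 * q * m) ^ (j + 1) *
          ((j + 1).factorial * ((j + 1) + m))) := by
        calc n ^ j * n = n ^ (j + 1) := (pow_succ _ _).symm
          _ ≤ _ := h1
          _ ≤ (16 * q * m) ^ (j + 1) * ((j + 1).factorial * (((j + 1) + m) * n ^ j)) := by
            refine Nat.mul_le_mul_left _ (Nat.mul_le_mul_left _ (h2.trans ?_))
            exact Nat.mul_le_mul_right _ (by omega)
          _ = _ := by ring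
      have h4 := Nat.le_of_mul_le_mul_left h3 (by positivity)
      omega
    -- sizes
    have hU₂c : 8 * c * (U₂.card - 1) ≤ 2 * n := by
      have h1 := card_le_of_outdeg hT U₂ (n / (8 * c)) (by
        intro u hu
        rw [Nat.le_div_iff_mul_le (by omega)]
        have h2 : (U₂.filter (fun w => beats u w)).card ≤ (E u).card := by
          apply Finset.card_le_card
          intro w hw
          simp only [hU₂, hB, Finset.mem_filter, Finset.mem_univ, true_and] at hw
          simp only [hE, Finset.mem_filter, Finset.mem_univ, true_and]
          exact ⟨hw.1.1, hw.2⟩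
        have h3 := Nat.mul_le_mul_left (8 * c) h2
        have h4 := hU₂E u hu
        rw [mul_comm]
        omega)
      have h5 : U₂.card - 1 ≤ 2 * (n / (8 * c)) := by omega
      have h6 := Nat.mul_le_mul_left (8 * c) h5
      have h7 := Nat.mul_div_le n (8 * c)
      have h8 : 8 * c * (2 * (n / (8 * c))) = 2 * (8 * c * (n / (8 * c))) := by ring
      omega
    have hUc : 8 * (q * m) * (U.card - 1) ≤ 2 * n := by
      have hpos : 0 < 8 * (q * m) := by omega
      have h1 := card_le_of_outdeg hT U (n / (8 * (q * m))) (by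
        intro u hu
        rw [Nat.le_div_iff_mul_le hpos]
        have h2 : (U.filter (fun w => beats u w)).card ≤ (E u).card := by
          apply Finset.card_le_card
          intro w hw
          simp only [hU, hB, Finset.mem_filter, Finset.mem_univ, true_and] at hw
          simp only [hE, Finset.mem_filter, Finset.mem_univ, true_and]
          exact ⟨hw.1.1, hw.2⟩
        have h3 := Nat.mul_le_mul_left (8 * (q * m)) h2
        have h4 := hUE u hu
        rw [mul_comm]
        omega)
      have h5 : U.card - 1 ≤ 2 * (n / (8 * (q * m))) := by omega
      have h6 := Nat.mul_le_mul_left (8 * (q * m)) h5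
      have h7 := Nat.mul_div_le n (8 * (q * m))
      have h8 : 8 * (q * m) * (2 * (n / (8 * (q * m))))
        = 2 * (8 * (q * m) * (n / (8 * (q * m)))) := by ring
      omega
    have hUU₂ : U ⊆ U₂ := by
      intro u hu
      rw [hU, Finset.mem_filter] at hu
      rw [hU₂, Finset.mem_filter]
      refine ⟨hu.1, ?_⟩
      have := Nat.mul_le_mul_left q hu.2.le
      omega
    -- candidates
    have hcand : ∀ u ∈ U, U.card ≤ ((B \ U₂) \ E u).card := by
      intro u hu
      have h1 := Finset.le_card_sdiff (E u) (B \ U₂)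
      have h2 := Finset.le_card_sdiff U₂ B
      have h3 := hU₂E u (hUU₂ hu)
      have h4 := Finset.card_le_card hUU₂
      -- everything multiplied by `8 * c`
      have h5 : 8 * c * U.card ≤ 2 * n := by
        have h6 : 8 * (q * m) * (U.card - 1) = 8 * q * (U.card - 1) * m := by ring
        have h7 : 8 * q * (U.card - 1) * 1 ≤ 8 * q * (U.card - 1) * m :=
          Nat.mul_le_mul_left _ hm
        have h8 : 8 * (16 * c) * (U.card - 1) ≤ 8 * q * (U.card - 1) :=
          Nat.mul_le_mul_right _ (by omega)
        have h9 : 8 * (16 * c) * (U.card - 1) = 16 * (8 * c * (U.card - 1)) := by ring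
        have h10 : 8 * c * U.card ≤ 8 * c * (U.card - 1) + 8 * c := by
          rw [← Nat.mul_succ]; exact Nat.mul_le_mul_left _ (by omega)
        omega
      have h11 : 8 * c * U₂.card ≤ 3 * n := by
        have h10 : 8 * c * U₂.card ≤ 8 * c * (U₂.card - 1) + 8 * c := by
          rw [← Nat.mul_succ]; exact Nat.mul_le_mul_left _ (by omega)
        omega
      have h12 : 8 * c * B.card = 8 * (c * B.card) := by ring
      have h13 : 8 * c * (U.card + U₂.card + (E u).card) ≤ 8 * c * B.card := by
        rw [mul_add, mul_add]
        omega
      have h14 := Nat.le_of_mul_le_mul_left h13 (by omega)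
      omega
    obtain ⟨f, hfinj, hf⟩ := (Finset.all_card_le_biUnion_card_iff_exists_injective
      (fun u : U => (B \ U₂) \ E u)).1 (by
        intro s
        rcases Finset.eq_empty_or_nonempty s with rfl | ⟨u, hu⟩
        · simp
        · have h1 : s.card ≤ U.card := by
            have := Finset.card_le_univ s
            simpa using this
          refine h1.trans ((hcand u.1 u.2).trans (Finset.card_le_card ?_))
          exact Finset.subset_biUnion_of_mem (fun u : U => (B \ U₂) \ E u) hu)
    set g : V → V := fun u => if h : u ∈ U then f ⟨u, h⟩ else u with hg
    have hg' : ∀ u (h : u ∈ U), g u = f ⟨u, h⟩ := fun u h => by simp [hg, h]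
    have hgm : ∀ u ∈ U, (beats (g u) v ∧ n ≤ q * (D (g u)).card) ∧ ¬ beats u (g u) := by
      intro u hu
      have h1 := hf ⟨u, hu⟩
      rw [← hg' u hu] at h1
      simp only [Finset.mem_sdiff, hU₂, Finset.mem_filter, hBv, hE, Finset.mem_univ,
        true_and, not_and, not_lt] at h1
      exact ⟨⟨h1.1.1, h1.1.2 h1.1.1⟩, h1.2 h1.1.1⟩
    have hgU : ∀ u ∈ U, g u ∉ U := by
      intro u hu h
      have h1 := (hgm u hu).1.2
      have h2 := Finset.mem_filter.1 (hUU₂ h)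
      omega
    refine core_wins hT v m hm (hcard.trans hn) U g ?_ ?_ ?_ ?_ ?_ hgU ?_
    · intro u hu
      rw [hU, Finset.mem_filter, hBv] at hu
      exact hu.1
    · intro b hbv hbU
      rw [hU, Finset.mem_filter, hBv] at hbU
      change m ≤ (D b).card
      by_contra h
      exact hbU ⟨hbv, by omega⟩
    · intro x hx y hy hxy
      rw [hg' x hx, hg' y hy] at hxy
      simpa using hfinj hxy
    · intro u hu
      rcases hT.total u (g u) (fun h => hgU u hu (h ▸ hu)) with h | h
      · exact absurd h (hgm u hu).2
      · exact h
    · intro u hu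
      exact (hgm u hu).1.1
    · intro u hu
      change 2 * m * U.card + m ≤ (D (g u)).card
      have h1 := (hgm u hu).1.2
      have h2 : q * (2 * m * U.card + m) ≤ q * (D (g u)).card := by
        refine le_trans ?_ h1
        have h3 : q * (2 * m * U.card + m) ≤ 2 * (q * m) * (U.card - 1) + 3 * (q * m) := by
          have : U.card ≤ (U.card - 1) + 1 := by omega
          calc q * (2 * m * U.card + m) ≤ q * (2 * m * ((U.card - 1) + 1) + m) :=
                Nat.mul_le_mul_left _ (Nat.add_le_add_right (Nat.mul_le_mul_left _ this) _)
            _ = _ := by ring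
        have h4 : 8 * (q * m) * (U.card - 1) = 4 * (2 * (q * m) * (U.card - 1)) := by ring
        omega
      exact Nat.le_of_mul_le_mul_left h2 (by omega)

end Final

/-- for every fixed `k ≥ 1`, in every large enough tournament whose
size is a power of two, a player maximizing the number of `k`-paths originating
from it is an SE winner. -/
theorem kpath_maximizer_SE_winner (k : ℕ) (hk : 1 ≤ k) :
    ∃ N : ℕ, ∀ (V : Type) [Fintype V] (beats : V → V → Prop),
      IsTournament beats → N ≤ Fintype.card V → (∃ m : ℕ, Fintype.card V = 2 ^ m) →
      ∀ v : V, (∀ u : V, kPathCount beats k u ≤ kPathCount beats k v) →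
      SEWinner beats Finset.univ v := by
  obtain ⟨j, rfl⟩ : ∃ j, k = j + 1 := ⟨k - 1, by omega⟩
  obtain ⟨c, hc⟩ : ∃ c, c = 4 ^ (j + 1) * (j + 1).factorial := ⟨_, rfl⟩
  obtain ⟨q, hq⟩ : ∃ q, q = 2 * (16 * c) ^ (j + 1) * (j + 1).factorial + 1 := ⟨_, rfl⟩
  obtain ⟨M₁, hM₁⟩ := eventually_big ((16 * q) ^ (j + 1) * ((j + 1).factorial * (j + 2))) (j + 2)
  obtain ⟨M₂, hM₂⟩ := eventually_big (16 * q * (j + 1)) 1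
  refine ⟨2 ^ (M₁ + M₂ + 1), ?_⟩
  intro V _ beats hT hN hm v hv
  classical
  obtain ⟨m, hm⟩ := hm
  rw [hm] at hN
  have hmM : M₁ + M₂ + 1 ≤ m := (Nat.pow_le_pow_iff_right (by norm_num)).1 hN
  refine main_case hT j m c q (2 ^ m) (by omega) rfl hm hc hq ?_ ?_ v ?_
  · refine lt_of_le_of_lt ?_ (hM₁ m (by omega))
    have h1 : j + 1 + m ≤ (j + 2) * m := by nlinarith [show 1 ≤ m by omega]
    calc (16 * q * m) ^ (j + 1) * ((j + 1).factorial * (j + 1 + m))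
        ≤ (16 * q * m) ^ (j + 1) * ((j + 1).factorial * ((j + 2) * m)) :=
          Nat.mul_le_mul_left _ (Nat.mul_le_mul_left _ h1)
      _ = _ := by rw [mul_pow]; ring
  · have := hM₂ m (by omega)
    rw [pow_one] at this
    exact this.le
  · intro u
    rw [← kPathCount_eq, ← kPathCount_eq]
    exact hv u
end

section
/- For every real number r ∈ (0,1) there exists a tournament T on a power-of-two number of players such that, writing UC for the uncovered set of T (its set of kings) and W for its set of SE winners, one has |UC ∩ W| < r·|UC| and |UC ∩ W| < r·|W|. -/
/-- Round-indexed version of `SEWinner`. -/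
def RR {V : Type*} (beats : V → V → Prop) : ℕ → Finset V → V → Prop
  | 0, S, v => S = {v}
  | p + 1, S, v => ∃ (W : Finset V) (f : V → V),
      (∀ x ∈ S, f x ∈ S ∧ f x ≠ x ∧ f (f x) = x) ∧
      (∀ x, x ∈ W ↔ x ∈ S ∧ beats x (f x)) ∧ RR beats p W v

theorem RR.toSE {V : Type*} {beats : V → V → Prop} : ∀ (p : ℕ) (S : Finset V) (v : V),
    RR beats p S v → SEWinner beats S v
  | 0, S, v, h => by
      have h' : S = {v} := h
      subst h'
      exact SEWinner.single v
  | p + 1, S, v, h => by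
      obtain ⟨W, f, hf, hW, hw⟩ := h
      exact SEWinner.round S W f v hf hW (RR.toSE p W v hw)

theorem RR.merge {V : Type*} [DecidableEq V] {beats : V → V → Prop} (ht : IsTournament beats) :
    ∀ (p : ℕ) (S T : Finset V) (v w : V), RR beats p S v → RR beats p T w → Disjoint S T →
      beats v w → RR beats (p + 1) (S ∪ T) v
  | 0, S, T, v, w, h1, h2, hd, hb => by
      have h1' : S = {v} := h1
      have h2' : T = {w} := h2
      subst h1' h2'
      have hvw : v ≠ w := by simpa using hd
      have hn := ht.asymm _ _ hb
      refine ⟨{v}, fun z => if z = v then w else v, ?_, ?_, rfl⟩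
      · intro x hx
        simp only [Finset.mem_union, Finset.mem_singleton] at hx ⊢
        rcases hx with rfl | rfl
        · simp [hvw.symm]
        · simp [hvw, hvw.symm]
      · intro x
        simp only [Finset.mem_union, Finset.mem_singleton]
        constructor
        · rintro rfl
          simpa using hb
        · rintro ⟨rfl | rfl, h⟩
          · rfl
          · simp [hvw.symm, hn] at h
  | p + 1, S, T, v, w, h1, h2, hd, hb => by
      obtain ⟨W1, f1, hf1, hW1, hw1⟩ := h1
      obtain ⟨W2, f2, hf2, hW2, hw2⟩ := h2
      have hd' := Finset.disjoint_left.1 hd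
      refine ⟨W1 ∪ W2, fun z => if z ∈ S then f1 z else f2 z, ?_, ?_, ?_⟩
      · intro x hx
        grind
      · intro x
        grind
      · refine RR.merge ht p W1 W2 v w hw1 hw2 ?_ hb
        rw [Finset.disjoint_left]
        intro a ha hb'
        exact hd' ((hW1 a).1 ha).1 ((hW2 a).1 hb').1

theorem RR.exists_winner {V : Type*} [DecidableEq V] {beats : V → V → Prop}
    (ht : IsTournament beats) :
    ∀ (p : ℕ) (U : Finset V), U.card = 2 ^ p → ∃ w ∈ U, RR beats p U w
  | 0, U, h => by
      obtain ⟨w, rfl⟩ := Finset.card_eq_one.1 (by simpa using h)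
      exact ⟨w, by simp, rfl⟩
  | p + 1, U, h => by
      obtain ⟨A, hA, hc⟩ := Finset.exists_subset_card_eq (s := U) (n := 2 ^ p)
        (by rw [h, pow_succ]; omega)
      have hc2 : (U \ A).card = 2 ^ p := by
        rw [Finset.card_sdiff_of_subset hA, h, hc, pow_succ]; omega
      obtain ⟨v, hv, h1⟩ := RR.exists_winner ht p A hc
      obtain ⟨w, hw, h2⟩ := RR.exists_winner ht p (U \ A) hc2
      have hd : Disjoint A (U \ A) := Finset.disjoint_sdiff
      have hne : v ≠ w := by
        rintro rfl
        exact (Finset.mem_sdiff.1 hw).2 hv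
      rcases ht.total v w hne with hb | hb
      · refine ⟨v, hA hv, ?_⟩
        have := RR.merge ht p A (U \ A) v w h1 h2 hd hb
        rwa [Finset.union_sdiff_of_subset hA] at this
      · refine ⟨w, (Finset.mem_sdiff.1 hw).1, ?_⟩
        have := RR.merge ht p (U \ A) A w v h2 h1 hd.symm hb
        rwa [Finset.sdiff_union_of_subset hA] at this

theorem RR.extend {V : Type*} [DecidableEq V] {beats : V → V → Prop}
    (ht : IsTournament beats) (p : ℕ) (S : Finset V) (v : V) (hS : S.card = 2 ^ p)
    (h : RR beats p S v) : ∀ (j : ℕ) (T : Finset V), S ⊆ T → T.card = 2 ^ (p + j) →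
      (∀ u ∈ T, u ∉ S → beats v u) → RR beats (p + j) T v
  | 0, T, hST, hT, _ => by
      have : S = T := Finset.eq_of_subset_of_card_le hST (by rw [hS, hT]; simp)
      subst this
      exact h
  | j + 1, T, hST, hT, hb => by
      have h2 : 2 ^ p ≤ 2 ^ (p + j) := Nat.pow_le_pow_right (by norm_num) (by omega)
      have h3 : T.card = 2 ^ (p + j) + 2 ^ (p + j) := by
        rw [hT, ← add_assoc, pow_succ]; omega
      obtain ⟨U, hU, hc⟩ := Finset.exists_subset_card_eq (s := T \ S) (n := 2 ^ (p + j))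
        (by rw [Finset.card_sdiff_of_subset hST]; omega)
      have hUT : U ⊆ T := hU.trans Finset.sdiff_subset
      have hi := RR.extend ht p S v hS h j (T \ U)
        (by intro x hx
            refine Finset.mem_sdiff.2 ⟨hST hx, fun hxU => (Finset.mem_sdiff.1 (hU hxU)).2 hx⟩)
        (by rw [Finset.card_sdiff_of_subset hUT]; omega)
        (fun u hu hn => hb u (Finset.mem_sdiff.1 hu).1 hn)
      obtain ⟨w, hw, h4⟩ := RR.exists_winner ht (p + j) U hc
      have hw' := Finset.mem_sdiff.1 (hU hw)
      have := RR.merge ht (p + j) (T \ U) U v w hi h4 Finset.sdiff_disjoint (hb w hw'.1 hw'.2)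
      rwa [Finset.sdiff_union_of_subset hUT] at this

theorem RR.star {V : Type*} [DecidableEq V] {beats : V → V → Prop}
    (ht : IsTournament beats) (p : ℕ) (T : Finset V) (v : V) (hv : v ∈ T) (hT : T.card = 2 ^ p)
    (hb : ∀ u ∈ T, u ≠ v → beats v u) : RR beats p T v := by
  have := RR.extend ht 0 {v} v (by simp) rfl p T (by simpa using hv) (by simpa using hT)
    (by intro u hu hn; exact hb u hu (by simpa using hn))
  simpa using this

theorem SEWinner.mem' {V : Type*} {beats : V → V → Prop} {S : Finset V} {v : V}
    (h : SEWinner beats S v) : v ∈ S := by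
  induction h with
  | single v => simp
  | round S W f v hf hW hw ih => exact ((hW v).1 ih).1

open Classical in
theorem SEWinner.card_le {V : Type*} {beats : V → V → Prop} (ht : IsTournament beats)
    {S : Finset V} {v : V}
    (h : SEWinner beats S v) : S.card ≤ 2 ^ (S.filter (fun u => beats v u)).card := by
  induction h with
  | single v => simpa using Nat.one_le_two_pow
  | round S W f v hf hW hw ih =>
    have hv := (hW v).1 hw.mem'
    have h1 : (W.filter (fun u => beats v u)).card < (S.filter (fun u => beats v u)).card := by
      apply Finset.card_lt_card
      rw [Finset.ssubset_iff_of_subset]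
      · refine ⟨f v, ?_, ?_⟩
        · simp [(hf v hv.1).1, hv.2]
        · intro hc
          have := ((hW _).1 (Finset.mem_filter.1 hc).1).2
          rw [(hf v hv.1).2.2] at this
          exact ht.asymm _ _ hv.2 this
      · intro x hx
        have hx' := Finset.mem_filter.1 hx
        exact Finset.mem_filter.2 ⟨((hW x).1 hx'.1).1, hx'.2⟩
    have h2 : S ⊆ W ∪ W.image f := by
      intro x hx
      obtain ⟨a, b, c⟩ := hf x hx
      rcases ht.total x (f x) b.symm with h | h
      · exact Finset.mem_union_left _ ((hW x).2 ⟨hx, h⟩)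
      · refine Finset.mem_union_right _ (Finset.mem_image.2 ⟨f x, (hW _).2 ⟨a, ?_⟩, c⟩)
        rwa [c]
    have h3 := Finset.card_le_card h2
    have h4 := Finset.card_union_le W (W.image f)
    have h5 : (W.image f).card ≤ W.card := Finset.card_image_le
    calc S.card ≤ 2 * W.card := by omega
      _ ≤ 2 * 2 ^ (W.filter (fun u => beats v u)).card := by omega
      _ = 2 ^ ((W.filter (fun u => beats v u)).card + 1) := by rw [pow_succ]; omega
      _ ≤ _ := Nat.pow_le_pow_right (by norm_num) h1

/-- Pairs `x < y` in which the larger index wins. -/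
def exc (n N : ℕ) (x y : ℕ) : Prop :=
  (x = 0 ∧ n - N ≤ y) ∨ (2 ≤ x ∧ x < N ∧ y = n - 1) ∨
    (n - N ≤ x ∧ y < n - 1 ∧ N < 2 * (y - x) + 2)

/-- The tournament. -/
def bt (n N : ℕ) (x y : Fin n) : Prop :=
  (x.val < y.val ∧ ¬ exc n N x y) ∨ (y.val < x.val ∧ exc n N y x)

theorem bt_tour (n N : ℕ) : IsTournament (bt n N) where
  irrefl v := by unfold bt; omega
  asymm u v := by unfold bt; rintro (h | h) (h' | h') <;> first | omega | tauto
  total u v h := by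
    have : u.val ≠ v.val := fun h' => h (Fin.ext h')
    unfold bt
    rcases lt_or_gt_of_ne this with h1 | h1
    · by_cases h2 : exc n N u v <;> simp [h1, h2]
    · by_cases h2 : exc n N v u <;> simp [h1, h2]

theorem bt_king (n N : ℕ) (h4 : 4 ≤ N) (hE : Even N) (hn : 4 * N ≤ n) (x : Fin n)
    (h1 : n - N ≤ x.val) (h2 : x.val < n - 1) : IsKing (bt n N) x := by
  intro u hu
  have hu' : u.val ≠ x.val := fun h' => hu (Fin.ext h')
  have hul := u.isLt
  obtain ⟨k, hk⟩ := hE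
  by_cases ha : u.val = 0 ∨ u.val = n - 1
  · left; unfold bt exc; omega
  by_cases hb : u.val < n - N
  · right
    refine ⟨⟨0, by omega⟩, ?_, ?_⟩ <;> (unfold bt exc; simp only [true_and, and_true]; omega)
  by_cases hc : bt n N x u
  · exact Or.inl hc
  right
  by_cases hlt : x.val < u.val
  · refine ⟨⟨x.val + (k - 1), ?_⟩, ?_, ?_⟩ <;> (unfold bt exc at *; (try simp only [true_and, and_true]); omega)
  by_cases hs : n - N + k ≤ x.val
  · refine ⟨⟨x.val - k, ?_⟩, ?_, ?_⟩ <;> (unfold bt exc at *; (try simp only [true_and, and_true]); omega)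
  · refine ⟨⟨x.val + (k - 1), ?_⟩, ?_, ?_⟩ <;> (unfold bt exc at *; (try simp only [true_and, and_true]); omega)

theorem bt_not_king (n N : ℕ) (h4 : 4 ≤ N) (hn : 4 * N ≤ n) (x : Fin n)
    (h1 : 2 ≤ x.val) (h2 : x.val < n - N) : ¬ IsKing (bt n N) x := by
  intro h
  have := h ⟨1, by omega⟩ (by intro h'; rw [← h'] at h1; simp at h1)
  rcases this with h | ⟨w, h, h'⟩ <;> (unfold bt exc at *; simp only [true_and, and_true] at *; omega)

theorem bt_not_SE (n N : ℕ) (h4 : 4 ≤ N) (hn : 4 * N ≤ n) (hm : n = 2 ^ (N + 1)) (x : Fin n)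
    (h1 : n - N ≤ x.val) (h2 : x.val < n - 1) : ¬ SEWinner (bt n N) Finset.univ x := by
  classical
  intro h
  have h3 := SEWinner.card_le (bt_tour n N) h
  rw [Finset.card_univ, Fintype.card_fin] at h3
  have h5 : 2 ^ (N + 1) ≤ 2 ^ (Finset.univ.filter (fun u => bt n N x u)).card := by
    rw [← hm]; convert h3
  have h6 := (Nat.pow_le_pow_iff_right (by norm_num)).1 h5
  have h7 : Finset.univ.filter (fun u => bt n N x u) ⊆
      insert (⟨0, by omega⟩ : Fin n) ((Finset.Ici (⟨n - N, by omega⟩ : Fin n)).erase x) := by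
    intro u hu
    have hu := (Finset.mem_filter.1 hu).2
    simp only [Finset.mem_insert, Finset.mem_erase, Finset.mem_Ici, Fin.le_def, Fin.ext_iff, ne_eq]
    unfold bt exc at hu
    omega
  have h8 := Finset.card_le_card h7
  have h9 := Finset.card_insert_le (⟨0, by omega⟩ : Fin n)
    ((Finset.Ici (⟨n - N, by omega⟩ : Fin n)).erase x)
  have h10 : ((Finset.Ici (⟨n - N, by omega⟩ : Fin n)).erase x).card = N - 1 := by
    rw [Finset.card_erase_of_mem (by simpa [Fin.le_def] using h1), Fin.card_Ici]
    simp only []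
    omega
  omega

theorem bt_SE (n q m : ℕ) (h4 : 4 ≤ 2 ^ q) (hm : n = 2 ^ m) (hn : 4 * 2 ^ q ≤ n) (x : Fin n)
    (h1 : 2 ≤ x.val) (h2 : x.val < 2 ^ q) : SEWinner (bt n (2 ^ q)) Finset.univ x := by
  have ht := bt_tour n (2 ^ q)
  have hq : 2 ≤ q := (Nat.pow_le_pow_iff_right (a := 2) (by norm_num)).1 (by simpa using h4)
  have hqm : q + 2 ≤ m := (Nat.pow_le_pow_iff_right (a := 2) (by norm_num)).1
    (by rw [← hm, pow_add]; omega)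
  have hp1 : 2 ^ (q + 1) = 2 * 2 ^ q := by rw [pow_succ]; omega
  have hp2 : 2 ^ (q + 2) = 4 * 2 ^ q := by rw [pow_add]; omega
  obtain ⟨N, hN⟩ : ∃ N, N = 2 ^ q := ⟨_, rfl⟩
  rw [← hN] at h4 hn h2 ht hp1 hp2 ⊢
  let z : Fin n := ⟨0, by omega⟩
  let b : Fin n := ⟨1, by omega⟩
  let s : Fin n := ⟨n - 1, by omega⟩
  let e : Fin n := ⟨N, by omega⟩
  obtain ⟨d, hd2, hdN, hdx⟩ : ∃ d : Fin n, 2 ≤ d.val ∧ d.val < N ∧ d.val ≠ x.val := by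
    by_cases h : x.val = 2
    · exact ⟨⟨3, by omega⟩, by simp, by simp only []; omega, by simp only []; omega⟩
    · exact ⟨⟨2, by omega⟩, by simp, by simp only []; omega, by simp only []; omega⟩
  have r1 : RR (bt n N) 1 {z, b} z := by
    apply RR.star ht
    · simp
    · rw [Finset.card_pair (by simp [z, b])]; rfl
    · intro u hu hne
      simp only [Finset.mem_insert, Finset.mem_singleton] at hu
      rcases hu with rfl | rfl
      · exact absurd rfl hne
      · unfold bt exc; simp only [z, b, true_and, and_true]; omega
  have r2 : RR (bt n N) 1 {s, d} s := by
    apply RR.star ht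
    · simp
    · rw [Finset.card_pair (by simp only [s, ne_eq, Fin.ext_iff]; omega)]; rfl
    · intro u hu hne
      simp only [Finset.mem_insert, Finset.mem_singleton] at hu
      rcases hu with rfl | rfl
      · exact absurd rfl hne
      · unfold bt exc; simp only [s, true_and, and_true]; omega
  have r3 := RR.merge ht 1 _ _ s z r2 r1
    (by rw [Finset.disjoint_left]
        intro a
        simp only [Finset.mem_insert, Finset.mem_singleton, Fin.ext_iff, z, b, s]
        omega)
    (by unfold bt exc; simp only [s, z, true_and, and_true]; omega)
  let Q : Finset (Fin n) := insert z (insert b (insert s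
    ((Finset.Ico (⟨2, by omega⟩ : Fin n) ⟨N, by omega⟩).erase x)))
  have hQm : ∀ u : Fin n, u ∈ Q ↔ u.val = 0 ∨ u.val = 1 ∨ u.val = n - 1 ∨
      (u.val ≠ x.val ∧ 2 ≤ u.val ∧ u.val < N) := by
    intro u
    simp only [Q, z, b, s, Finset.mem_insert, Finset.mem_erase, Finset.mem_Ico, Fin.ext_iff,
      Fin.le_def, Fin.lt_def, ne_eq]
  have hQc : Q.card = N := by
    simp only [Q]
    rw [Finset.card_insert_of_notMem, Finset.card_insert_of_notMem, Finset.card_insert_of_notMem,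
      Finset.card_erase_of_mem, Fin.card_Ico]
    · simp only []; omega
    · simp only [Finset.mem_Ico, Fin.le_def, Fin.lt_def]; omega
    all_goals
      simp only [z, b, s, Finset.mem_insert, Finset.mem_erase, Finset.mem_Ico, Fin.ext_iff,
        Fin.le_def, Fin.lt_def, ne_eq]
      omega
  have r4 : RR (bt n N) q Q s := by
    have := RR.extend ht 2 _ s ?_ r3 (q - 2) Q ?_ ?_ ?_
    · rwa [show 2 + (q - 2) = q by omega] at this
    · rw [Finset.card_union_of_disjoint, Finset.card_pair, Finset.card_pair]
      · rfl
      · simp [z, b]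
      · simp only [s, ne_eq, Fin.ext_iff]; omega
      · rw [Finset.disjoint_left]
        intro a
        simp only [Finset.mem_insert, Finset.mem_singleton, Fin.ext_iff, z, b, s]
        omega
    · intro u
      rw [hQm]
      simp only [Finset.mem_union, Finset.mem_insert, Finset.mem_singleton, Fin.ext_iff, z, b, s]
      omega
    · rw [show 2 + (q - 2) = q by omega, ← hN, hQc]
    · intro u
      rw [hQm]
      simp only [Finset.mem_union, Finset.mem_insert, Finset.mem_singleton, Fin.ext_iff, z, b, s]
      unfold bt exc
      simp only [true_and, and_true]
      omega
  let P : Finset (Fin n) := insert e (Finset.Ico (⟨n - N, by omega⟩ : Fin n) s)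
  have hPm : ∀ u : Fin n, u ∈ P ↔ u.val = N ∨ (n - N ≤ u.val ∧ u.val < n - 1) := by
    intro u
    simp only [P, e, s, Finset.mem_insert, Finset.mem_Ico, Fin.ext_iff, Fin.le_def, Fin.lt_def]
  have hPc : P.card = N := by
    simp only [P]
    rw [Finset.card_insert_of_notMem, Fin.card_Ico]
    · simp only [s]; omega
    · simp only [e, s, Finset.mem_Ico, Fin.le_def, Fin.lt_def]
      omega
  have r5 : RR (bt n N) q P e := by
    apply RR.star ht
    · simp [P]
    · rw [hPc, hN]
    · intro u
      rw [hPm]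
      simp only [e, ne_eq, Fin.ext_iff]
      unfold bt exc
      simp only [true_and, and_true]
      omega
  have hPQ : Disjoint P Q := by
    rw [Finset.disjoint_left]
    intro a
    rw [hPm, hQm]
    omega
  have r6 := RR.merge ht q P Q e s r5 r4 hPQ (by unfold bt exc; simp only [e, s, true_and, and_true]; omega)
  let S : Finset (Fin n) := insert x (Finset.Ico (⟨N + 1, by omega⟩ : Fin n) ⟨3 * N, by omega⟩)
  have hSm : ∀ u : Fin n, u ∈ S ↔ u.val = x.val ∨ (N + 1 ≤ u.val ∧ u.val < 3 * N) := by
    intro u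
    simp only [S, Finset.mem_insert, Finset.mem_Ico, Fin.ext_iff, Fin.le_def, Fin.lt_def]
  have hSc : S.card = 2 * N := by
    simp only [S]
    rw [Finset.card_insert_of_notMem, Fin.card_Ico]
    · simp only []; omega
    · simp only [Finset.mem_Ico, Fin.le_def, Fin.lt_def]
      omega
  have r7 : RR (bt n N) (q + 1) S x := by
    apply RR.star ht
    · simp [S]
    · rw [hSc, hp1]
    · intro u
      rw [hSm]
      simp only [ne_eq, Fin.ext_iff]
      unfold bt exc
      omega
  have hSPQ : Disjoint S (P ∪ Q) := by
    rw [Finset.disjoint_left]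
    intro a
    rw [Finset.mem_union, hPm, hQm, hSm]
    omega
  have r8 := RR.merge ht (q + 1) S (P ∪ Q) x e r7 r6 hSPQ (by unfold bt exc; simp only [e, true_and, and_true]; omega)
  have r9 := RR.extend ht (q + 2) _ x
    (by rw [Finset.card_union_of_disjoint hSPQ, Finset.card_union_of_disjoint hPQ]; omega)
    r8 (m - (q + 2)) Finset.univ (Finset.subset_univ _)
    (by rw [Finset.card_univ, Fintype.card_fin, hm]; congr 1; omega)
    (by intro u _
        rw [Finset.mem_union, Finset.mem_union, hPm, hQm, hSm]
        unfold bt exc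
        omega)
  exact RR.toSE _ _ _ r9

/-- for every `r ∈ (0,1)` there is a tournament (on a power-of-two
number of players) where the uncovered set `UC` (the kings) and the set `W` of SE
winners satisfy `|UC ∩ W| < r·|UC|` and `|UC ∩ W| < r·|W|`. -/
theorem kings_vs_SE_winners (r : ℝ) (hr0 : 0 < r) (hr1 : r < 1) :
    ∃ (n m : ℕ) (beats : Fin n → Fin n → Prop), n = 2 ^ m ∧ IsTournament beats ∧
      (({v : Fin n | IsKing beats v} ∩ {v : Fin n | SEWinner beats Finset.univ v}).ncard : ℝ)
        < r * ({v : Fin n | IsKing beats v}.ncard : ℝ) ∧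
      (({v : Fin n | IsKing beats v} ∩ {v : Fin n | SEWinner beats Finset.univ v}).ncard : ℝ)
        < r * ({v : Fin n | SEWinner beats Finset.univ v}.ncard : ℝ) := by
  obtain ⟨k, hk⟩ := exists_nat_gt (3 / r + 2)
  have hk' : k < 2 ^ (k + 2) :=
    lt_trans (Nat.lt_two_pow_self) (Nat.pow_lt_pow_right (by norm_num) (by omega))
  have h4 : 4 ≤ 2 ^ (k + 2) := by
    rw [pow_add]; have := Nat.one_le_two_pow (n := k); omega
  have hE : Even (2 ^ (k + 2)) := by
    rw [pow_succ]; exact even_two.mul_left _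
  obtain ⟨q, hq⟩ : ∃ q, q = k + 2 := ⟨_, rfl⟩
  rw [← hq] at hk' h4 hE
  have hn : 4 * 2 ^ q ≤ 2 ^ (2 ^ q + 1) := by
    have h5 : q < 2 ^ q := Nat.lt_two_pow_self
    have : 2 ^ (q + 2) ≤ 2 ^ (2 ^ q + 1) := Nat.pow_le_pow_right (by norm_num) (by omega)
    rw [pow_add] at this
    omega
  have hbig : (3 : ℝ) < r * ((2 ^ q : ℕ) - 2 : ℝ) := by
    have h6 : (k : ℝ) < ((2 ^ q : ℕ) : ℝ) := by exact_mod_cast hk'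
    have h7 : 3 / r < ((2 ^ q : ℕ) : ℝ) - 2 := by linarith
    rw [div_lt_iff₀ hr0] at h7
    linarith
  obtain ⟨n, hnn⟩ : ∃ n, n = 2 ^ (2 ^ q + 1) := ⟨_, rfl⟩
  rw [← hnn] at hn
  have key : ∀ x : Fin n, 2 ≤ x.val → x.val < 2 ^ q →
      SEWinner (bt n (2 ^ q)) Finset.univ x := bt_SE n q _ h4 hnn hn
  obtain ⟨N, hN⟩ : ∃ N, N = 2 ^ q := ⟨_, rfl⟩
  rw [← hN] at hn hbig h4 hE hnn key
  refine ⟨n, N + 1, bt n N, hnn, bt_tour n N, ?_⟩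
  have hI : ({v : Fin n | IsKing (bt n N) v} ∩
      {v : Fin n | SEWinner (bt n N) Finset.univ v}).ncard ≤ 3 := by
    have hsub : ({v : Fin n | IsKing (bt n N) v} ∩
        {v : Fin n | SEWinner (bt n N) Finset.univ v}) ⊆
        (({⟨0, by omega⟩, ⟨1, by omega⟩, ⟨n - 1, by omega⟩} : Finset (Fin n)) : Set (Fin n)) := by
      rintro v ⟨hv1, hv2⟩
      simp only [Set.mem_setOf_eq] at hv1 hv2
      by_contra hc
      simp only [Finset.coe_insert, Finset.coe_singleton, Set.mem_insert_iff,
        Set.mem_singleton_iff, Fin.ext_iff] at hc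
      have hvl := v.isLt
      by_cases h : v.val < n - N
      · exact bt_not_king n N h4 hn v (by omega) h hv1
      · exact bt_not_SE n N h4 hn hnn v (by omega) (by omega) hv2
    refine (Set.ncard_le_ncard hsub (Finset.finite_toSet _)).trans ?_
    rw [Set.ncard_coe_finset]
    exact Finset.card_le_three
  have hK : N - 2 ≤ ({v : Fin n | IsKing (bt n N) v}).ncard := by
    have hsub : ((Finset.Ico (⟨n - N, by omega⟩ : Fin n) ⟨n - 1, by omega⟩ : Finset (Fin n)) :
        Set (Fin n)) ⊆ {v : Fin n | IsKing (bt n N) v} := by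
      intro v hv
      simp only [Finset.coe_Ico, Set.mem_Ico, Fin.le_def, Fin.lt_def] at hv
      exact bt_king n N h4 hE hn v hv.1 hv.2
    have := Set.ncard_le_ncard hsub (Set.toFinite _)
    rw [Set.ncard_coe_finset, Fin.card_Ico] at this
    simp only [] at this
    omega
  have hW : N - 2 ≤ ({v : Fin n | SEWinner (bt n N) Finset.univ v}).ncard := by
    have hsub : ((Finset.Ico (⟨2, by omega⟩ : Fin n) ⟨N, by omega⟩ : Finset (Fin n)) :
        Set (Fin n)) ⊆ {v : Fin n | SEWinner (bt n N) Finset.univ v} := by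
      intro v hv
      simp only [Finset.coe_Ico, Set.mem_Ico, Fin.le_def, Fin.lt_def] at hv
      exact key v hv.1 hv.2
    have := Set.ncard_le_ncard hsub (Set.toFinite _)
    rw [Set.ncard_coe_finset, Fin.card_Ico] at this
    simpa using this
  have fin : ∀ a b : ℕ, a ≤ 3 → N - 2 ≤ b → (a : ℝ) < r * (b : ℝ) := by
    intro a b ha hb
    have ha' : (a : ℝ) ≤ 3 := by exact_mod_cast ha
    have hb' : (N : ℝ) ≤ b + 2 := by exact_mod_cast (show N ≤ b + 2 by omega)
    have : r * ((N : ℝ) - 2) ≤ r * b := mul_le_mul_of_nonneg_left (by linarith) hr0.le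
    linarith
  exact ⟨fin _ _ hI hK, fin _ _ hI hW⟩
end

section
/- Let T be a tournament on players v_1, …, v_n, and let Q be the n×n column-stochastic matrix with Q_{ij} = 1/n if v_i beats v_j, Q_{ij} = 0 if v_j beats v_i (i ≠ j), and Q_{ii} = (out(v_i) + 1)/n. If p is a probability vector satisfying Qp = p and the entry p_i is maximal among all entries of p, then out(v_i) ≥ (n − 1)/2. -/
/-- every member of the Markov set beats at least `(n-1)/2`
players. -/
theorem markov_set_high_outdegree {V : Type*} [Fintype V] [DecidableEq V]
    (beats : V → V → Prop) [DecidableRel beats] (hT : IsTournament beats)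
    (Q : Matrix V V ℝ)
    (hQ : ∀ i j : V, Q i j =
      if i = j then ((outDeg beats i : ℝ) + 1) / (Fintype.card V : ℝ)
      else if beats i j then 1 / (Fintype.card V : ℝ) else 0)
    (p : V → ℝ) (hp0 : ∀ i, 0 ≤ p i) (hp1 : ∑ i, p i = 1)
    (hfix : Q.mulVec p = p)
    (i : V) (hmax : ∀ j : V, p j ≤ p i) :
    ((Fintype.card V : ℝ) - 1) / 2 ≤ (outDeg beats i : ℝ) := by
  have hpos : 0 < p i := by
    by_contra h
    have h0 : ∑ j, p j ≤ 0 := Finset.sum_nonpos fun j _ => (hmax j).trans (not_lt.mp h)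
    linarith
  have hn : (0 : ℝ) < (Fintype.card V : ℝ) := by
    exact_mod_cast Fintype.card_pos_iff.mpr ⟨i⟩
  have hout : (outDeg beats i : ℝ) = ∑ j, if beats i j then (1 : ℝ) else 0 := by
    rw [Finset.sum_boole, outDeg, Set.ncard_eq_toFinset_card']
    congr 2
    ext j
    simp
  have hterm : ∀ j, (Fintype.card V : ℝ) * (Q i j * p j) ≤
      ((if i = j then ((outDeg beats i : ℝ) + 1) else 0)
        + (if beats i j then (1 : ℝ) else 0)) * p i := by
    intro j
    rw [hQ]
    by_cases hij : i = j
    · subst hij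
      simp only [if_true, if_neg (hT.irrefl i)]
      apply le_of_eq
      field_simp
      ring
    · by_cases hb : beats i j
      · simp only [if_neg hij, if_pos hb]
        have : (Fintype.card V : ℝ) * (1 / (Fintype.card V : ℝ) * p j) = p j := by
          field_simp
        rw [this]
        linarith [hmax j]
      · simp [hij, hb]
  have hsum : (Fintype.card V : ℝ) * p i ≤ ((outDeg beats i : ℝ) + 1 + outDeg beats i) * p i := by
    calc (Fintype.card V : ℝ) * p i = (Fintype.card V : ℝ) * ∑ j, Q i j * p j := by
          conv_lhs => rw [← hfix]
          rfl
      _ = ∑ j, (Fintype.card V : ℝ) * (Q i j * p j) := Finset.mul_sum _ _ _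
      _ ≤ ∑ j, ((if i = j then ((outDeg beats i : ℝ) + 1) else 0)
        + (if beats i j then (1 : ℝ) else 0)) * p i := Finset.sum_le_sum fun j _ => hterm j
      _ = ((outDeg beats i : ℝ) + 1 + outDeg beats i) * p i := by
          rw [← Finset.sum_mul, Finset.sum_add_distrib, ← hout]
          simp
  have := le_of_mul_le_mul_right hsum hpos
  linarith
end

section
/- For every integer k with 0 ≤ k ≤ n − 1, every tournament on n players contains at least C(n, k+1) directed k-paths, where a directed k-path is a sequence of k+1 distinct players in which each player beats the next. -/
theorem chain_insert_aux {V : Type*} {beats : V → V → Prop} (hT : IsTournament beats) (a : V)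
    (l : List V) (hl : l.IsChain beats) (ha : a ∉ l) :
    ∃ l' : List V, l'.Perm (a :: l) ∧ l'.IsChain beats ∧
      ∀ y ∈ l'.head?, y = a ∨ y ∈ l.head? := by
  induction l with
  | nil => exact ⟨[a], by simp⟩
  | cons b t ih =>
    simp only [List.mem_cons, not_or] at ha
    rw [List.isChain_cons] at hl
    rcases hT.total a b ha.1 with h | h
    · refine ⟨a :: b :: t, List.Perm.refl _, ?_, by simp⟩
      rw [List.isChain_cons_cons, List.isChain_cons]
      exact ⟨h, hl⟩
    · obtain ⟨t', hp, hc, hh⟩ := ih hl.2 ha.2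
      refine ⟨b :: t', (hp.cons b).trans (List.Perm.swap a b t), ?_, by simp⟩
      rw [List.isChain_cons]
      refine ⟨fun y hy => ?_, hc⟩
      rcases hh y hy with rfl | h'
      · exact h
      · exact hl.1 y h'

theorem chain_exists_aux {V : Type*} {beats : V → V → Prop} (hT : IsTournament beats)
    (l : List V) (hl : l.Nodup) : ∃ l' : List V, l'.Perm l ∧ l'.IsChain beats := by
  induction l with
  | nil => exact ⟨[], by simp⟩
  | cons a t ih =>
    rw [List.nodup_cons] at hl
    obtain ⟨t', hp, hc⟩ := ih hl.2
    obtain ⟨l', hp', hc', -⟩ := chain_insert_aux hT a t' hc (fun h => hl.1 (hp.mem_iff.1 h))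
    exact ⟨l', hp'.trans (hp.cons a), hc'⟩

/-- every tournament on `n` players contains at least `C(n, k+1)`
directed `k`-paths. -/
theorem min_kpaths {V : Type*} [Fintype V]
    (beats : V → V → Prop) (hT : IsTournament beats)
    (k : ℕ) (hk : k ≤ Fintype.card V - 1) :
    (Fintype.card V).choose (k + 1) ≤
      {p : Fin (k + 1) → V | Function.Injective p ∧
        ∀ i : Fin k, beats (p i.castSucc) (p i.succ)}.ncard := by
  classical
  set P : Set (Fin (k + 1) → V) := {p | Function.Injective p ∧
        ∀ i : Fin k, beats (p i.castSucc) (p i.succ)} with hP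
  have hfin : P.Finite := Set.toFinite P
  rw [Set.ncard_eq_toFinset_card P hfin, ← Finset.card_univ, ← Finset.card_powersetCard]
  refine le_trans (Finset.card_le_card ?_)
    (Finset.card_image_le (s := hfin.toFinset) (f := fun p => Finset.univ.image p))
  intro s hs
  rw [Finset.mem_powersetCard_univ] at hs
  obtain ⟨l, hp, hc⟩ := chain_exists_aux hT s.toList s.nodup_toList
  have hlen : l.length = k + 1 := by rw [hp.length_eq, Finset.length_toList, hs]
  have hnd : l.Nodup := hp.nodup_iff.2 s.nodup_toList
  rw [Finset.mem_image]
  refine ⟨fun i => l[i.1]'(by omega), ?_, ?_⟩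
  · rw [Set.Finite.mem_toFinset]
    refine ⟨fun i j h => ?_, fun i => ?_⟩
    · exact Fin.ext ((hnd.getElem_inj_iff).1 h)
    · exact List.isChain_iff_getElem.1 hc i.1 (by omega)
  · ext x
    rw [← Finset.mem_toList (s := s), ← hp.mem_iff, List.mem_iff_getElem]
    simp only [Finset.mem_image, Finset.mem_univ, true_and]
    constructor
    · rintro ⟨i, hi⟩
      exact ⟨i.1, by omega, hi⟩
    · rintro ⟨i, hi, h⟩
      exact ⟨⟨i, by omega⟩, h⟩
end

section
/- Let T be a tournament with adjacency matrix A (A_{uv} = 1 if u beats v, and 0 otherwise). If a player w covers a player v, i.e., w beats v and w beats every player that v beats, then for every integer k ≥ 1 the number of directed walks of length k starting at w is at least the number of directed walks of length k starting at v; equivalently, (A^k 𝟙)_w ≥ (A^k 𝟙)_v, where 𝟙 is the all-ones vector. -/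
/-- if `w` covers `v`, then for every `k ≥ 1` the number of directed
walks of length `k` starting at `w` is at least the number starting at `v`;
equivalently `(A^k 𝟙)_w ≥ (A^k 𝟙)_v` for the adjacency matrix `A`. -/
theorem covering_dominates_walks {V : Type*} [Fintype V] [DecidableEq V]
    (beats : V → V → Prop) [DecidableRel beats] (hT : IsTournament beats)
    (A : Matrix V V ℝ)
    (hA : ∀ u v : V, A u v = if beats u v then 1 else 0)
    (w v : V) (hwv : beats w v) (hcov : ∀ u : V, beats v u → beats w u)
    (k : ℕ) (hk : 1 ≤ k) :
    {p : Fin (k + 1) → V | p 0 = v ∧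
        ∀ i : Fin k, beats (p i.castSucc) (p i.succ)}.ncard ≤
      {p : Fin (k + 1) → V | p 0 = w ∧
        ∀ i : Fin k, beats (p i.castSucc) (p i.succ)}.ncard ∧
    (A ^ k).mulVec (fun _ => (1 : ℝ)) v ≤ (A ^ k).mulVec (fun _ => (1 : ℝ)) w := by
  obtain ⟨n, rfl⟩ : ∃ n, k = n + 1 := ⟨k - 1, by omega⟩
  constructor
  · refine Set.ncard_le_ncard_of_injOn (fun p => Function.update p 0 w) ?_ ?_ (Set.toFinite _)
    · rintro p ⟨hp0, hp⟩
      refine ⟨by simp, fun i => ?_⟩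
      have hs : Function.update p 0 w i.succ = p i.succ :=
        Function.update_of_ne (Fin.succ_ne_zero i) _ _
      simp only [hs]
      have h := hp i
      by_cases hi : i.castSucc = 0
      · rw [hi] at h ⊢
        rw [hp0] at h
        rw [Function.update_self]
        exact hcov _ h
      · rw [Function.update_of_ne hi]
        exact h
    · rintro p ⟨hp0, -⟩ q ⟨hq0, -⟩ hpq
      funext i
      by_cases hi : i = 0
      · rw [hi, hp0, hq0]
      · have h := congrFun hpq i
        simpa [Function.update_of_ne hi] using h
  · have hnn : ∀ (m : ℕ) (x : V), 0 ≤ (A ^ m).mulVec (fun _ => (1 : ℝ)) x := by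
      intro m
      induction m with
      | zero => intro x; simp
      | succ m ih =>
        intro x
        rw [pow_succ', ← Matrix.mulVec_mulVec]
        refine Finset.sum_nonneg fun y _ => mul_nonneg ?_ (ih y)
        simp only [hA]; split_ifs <;> norm_num
    rw [pow_succ', ← Matrix.mulVec_mulVec]
    refine Finset.sum_le_sum fun y _ => mul_le_mul_of_nonneg_right ?_ (hnn n y)
    simp only [hA]
    by_cases hv : beats v y
    · simp [hv, hcov y hv]
    · simp only [hv, if_false]; split_ifs <;> norm_num
end
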